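/- The number of pairs (v₁,v₂) of primitive integer vectors with det(v₁ v₂) = 1 and ‖v₁‖² + ‖v₂‖² ≤ R² is asymptotic to 6R² as R → ∞ (Newman's theorem: Count_3(R,1) ∼ 6R²). -/

import Mathlib

open Filter

/-- The set of pairs of primitive integer vectors with determinant 1 and Euclidean norm
squared sum at most `R²`. -/
def newmanSet (R : ℝ) : Set ((Fin 2 → ℤ) × (Fin 2 → ℤ)) :=
  {p | Int.gcd (p.1 0) (p.1 1) = 1 ∧ Int.gcd (p.2 0) (p.2 1) = 1 ∧
    p.1 0 * p.2 1 - p.1 1 * p.2 0 = 1 ∧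
    ((p.1 0 ^ 2 + p.1 1 ^ 2 + p.2 0 ^ 2 + p.2 1 ^ 2 : ℤ) : ℝ) ≤ R ^ 2}

lemma kl_count {F : Type*} [Field F] [Fintype F] [DecidableEq F] (x y : Fˣ) :
    ((Finset.univ : Finset (Fˣ × Fˣ)).filter (fun t => (x:F) + y - t.1 - t.2 = 0 ∧
      ((x⁻¹ : Fˣ):F) + (y⁻¹ : Fˣ) - (t.1⁻¹ : Fˣ) - (t.2⁻¹ : Fˣ) = 0)).card ≤
      if y = -x then Fintype.card F else 2 := by
  split_ifs with h
  · calc _ ≤ (Finset.univ : Finset F).card := by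
          apply Finset.card_le_card_of_injOn (fun t => (t.1 : F)) (by simp)
          rintro ⟨z, w⟩ h1 ⟨z', w'⟩ h2 h3
          simp only [Finset.coe_filter, Finset.mem_univ, true_and, Set.mem_setOf_eq] at h1 h2 h3
          have e1 : z = z' := Units.ext h3
          subst e1
          have : w = w' := by
            apply Units.ext
            linear_combination h2.1 - h1.1
          rw [this]
      _ = _ := by simp
  · calc _ ≤ ({(x,y),(y,x)} : Finset (Fˣ × Fˣ)).card := by
          apply Finset.card_le_card
          rintro ⟨z, w⟩ h1
          simp only [Finset.mem_filter, Finset.mem_univ, true_and] at h1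
          obtain ⟨h1, h2⟩ := h1
          have hs : (x:F) + y ≠ 0 := by
            intro h0
            apply h
            apply Units.ext
            push_cast
            linear_combination h0
          have hx := x.ne_zero
          have hy := y.ne_zero
          have hz := z.ne_zero
          have hw := w.ne_zero
          simp only [Units.val_inv_eq_inv_val] at h2
          have h3 : ((x:F)+y) * (z*w - x*y) = 0 := by
            field_simp at h2
            linear_combination h2 - x * y * h1
          have h4 : (z:F)*w - x*y = 0 := by
            rcases mul_eq_zero.1 h3 with h | h
            · exact absurd h hs
            · exact h
          have h5 : ((z:F) - x) * (z - y) = 0 := by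
            linear_combination -z * h1 - h4
          simp only [Finset.mem_insert, Finset.mem_singleton, Prod.mk.injEq]
          rcases mul_eq_zero.1 h5 with h | h
          · left
            constructor
            · exact Units.ext (by linear_combination h)
            · exact Units.ext (by linear_combination -h1 - h)
          · right
            constructor
            · exact Units.ext (by linear_combination h)
            · exact Units.ext (by linear_combination -h1 - h)
      _ ≤ 2 := Finset.card_le_two

lemma kl_count_total {F : Type*} [Field F] [Fintype F] [DecidableEq F] :
    ∑ x : Fˣ, ∑ y : Fˣ, ((Finset.univ : Finset (Fˣ × Fˣ)).filter (fun t => (x:F) + y - t.1 - t.2 = 0 ∧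
      ((x⁻¹ : Fˣ):F) + (y⁻¹ : Fˣ) - (t.1⁻¹ : Fˣ) - (t.2⁻¹ : Fˣ) = 0)).card ≤ 3 * Fintype.card F ^ 2 := by
  have hc : Fintype.card Fˣ ≤ Fintype.card F := Fintype.card_le_of_injective _ Units.val_injective
  calc _ ≤ ∑ x : Fˣ, ∑ y : Fˣ, (if y = -x then Fintype.card F else 2) := by
        gcongr with x _ y _
        exact kl_count x y
    _ ≤ ∑ x : Fˣ, ∑ y : Fˣ, ((if y = -x then Fintype.card F else 0) + 2) := by
        gcongr with x _ y _
        split_ifs <;> omega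
    _ = Fintype.card Fˣ * (Fintype.card F + Fintype.card Fˣ * 2) := by
        simp [Finset.sum_add_distrib]
    _ ≤ Fintype.card F * (Fintype.card F + Fintype.card F * 2) := by gcongr
    _ = _ := by ring

/-- Kloosterman sum over a finite ring. -/
noncomputable def klS {A : Type*} [CommRing A] [Fintype A] [DecidableEq A] (ψ : AddChar A ℂ) (h k : A) : ℂ :=
  ∑ u : Aˣ, ψ (h * u + k * (u⁻¹ : Aˣ))

lemma klS_pow4 {F : Type*} [Field F] [Fintype F] [DecidableEq F] (ψ : AddChar F ℂ) (h k : F) :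
    ((‖klS ψ h k‖ ^ 4 : ℝ) : ℂ) = ∑ x : Fˣ, ∑ y : Fˣ, ∑ t : Fˣ × Fˣ,
      ψ (h * ((x:F) + y - t.1 - t.2)) *
      ψ (k * (((x⁻¹ : Fˣ):F) + (y⁻¹ : Fˣ) - (t.1⁻¹ : Fˣ) - (t.2⁻¹ : Fˣ))) := by
  have h1 : ((‖klS ψ h k‖ ^ 4 : ℝ) : ℂ) = klS ψ h k * klS ψ h k *
      ((starRingEnd ℂ) (klS ψ h k) * (starRingEnd ℂ) (klS ψ h k)) := by
    have := Complex.mul_conj' (klS ψ h k)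
    push_cast
    linear_combination -(‖klS ψ h k‖ ^ 2 + klS ψ h k * (starRingEnd ℂ) (klS ψ h k)) * this
  rw [h1]
  have h2 : (starRingEnd ℂ) (klS ψ h k) = ∑ u : Fˣ, ψ (-(h * u + k * (u⁻¹ : Fˣ))) := by
    simp only [klS, map_sum, AddChar.map_neg_eq_conj]
  rw [h2]
  rw [klS, Finset.sum_mul_sum, Finset.sum_mul_sum, ← Finset.sum_product' (f := fun z w => ψ (-(h * z + k * (z⁻¹ : Fˣ))) * ψ (-(h * w + k * (w⁻¹ : Fˣ)))), Finset.sum_mul]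
  refine Finset.sum_congr rfl fun x _ => ?_
  rw [Finset.sum_mul]
  refine Finset.sum_congr rfl fun y _ => ?_
  rw [Finset.mul_sum]
  refine Finset.sum_congr rfl fun t _ => ?_
  simp only [← AddChar.map_add_eq_mul]
  congr 1
  ring

lemma klS_moment {F : Type*} [Field F] [Fintype F] [DecidableEq F] (ψ : AddChar F ℂ)
    (hψ : ψ.IsPrimitive) : ∑ t : F × F, ‖klS ψ t.1 t.2‖ ^ 4 ≤ 3 * (Fintype.card F : ℝ) ^ 4 := by
  have key : ((∑ t : F × F, ‖klS ψ t.1 t.2‖ ^ 4 : ℝ) : ℂ) = (Fintype.card F : ℂ)^2 *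
    ((∑ x : Fˣ, ∑ y : Fˣ, ((Finset.univ : Finset (Fˣ × Fˣ)).filter (fun t => (x:F) + y - t.1 - t.2 = 0 ∧
      ((x⁻¹ : Fˣ):F) + (y⁻¹ : Fˣ) - (t.1⁻¹ : Fˣ) - (t.2⁻¹ : Fˣ) = 0)).card : ℕ) : ℂ) := by
    rw [Complex.ofReal_sum]
    simp_rw [klS_pow4]
    rw [Finset.sum_comm]
    push_cast
    rw [Finset.mul_sum]
    refine Finset.sum_congr rfl fun x _ => ?_
    rw [Finset.sum_comm, Finset.mul_sum]
    refine Finset.sum_congr rfl fun y _ => ?_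
    rw [Finset.sum_comm, Finset.card_filter]
    push_cast
    rw [Finset.mul_sum]
    refine Finset.sum_congr rfl fun t _ => ?_
    rw [Fintype.sum_prod_type]
    simp only
    rw [← Finset.sum_mul_sum (s := Finset.univ) (t := Finset.univ) (f := fun i => ψ (i * _)) (g := fun j => ψ (j * _)), AddChar.sum_mulShift _ hψ, AddChar.sum_mulShift _ hψ]
    split_ifs <;> simp_all <;> ring
  have key2 : (∑ t : F × F, ‖klS ψ t.1 t.2‖ ^ 4 : ℝ) = (Fintype.card F : ℝ)^2 *
    ((∑ x : Fˣ, ∑ y : Fˣ, ((Finset.univ : Finset (Fˣ × Fˣ)).filter (fun t => (x:F) + y - t.1 - t.2 = 0 ∧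
      ((x⁻¹ : Fˣ):F) + (y⁻¹ : Fˣ) - (t.1⁻¹ : Fˣ) - (t.2⁻¹ : Fˣ) = 0)).card : ℕ) : ℝ) := by
    exact_mod_cast key
  rw [key2]
  have : ((∑ x : Fˣ, ∑ y : Fˣ, ((Finset.univ : Finset (Fˣ × Fˣ)).filter (fun t => (x:F) + y - t.1 - t.2 = 0 ∧
      ((x⁻¹ : Fˣ):F) + (y⁻¹ : Fˣ) - (t.1⁻¹ : Fˣ) - (t.2⁻¹ : Fˣ) = 0)).card : ℕ) : ℝ) ≤ 3 * (Fintype.card F : ℝ) ^ 2 := by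
    exact_mod_cast kl_count_total (F := F)
  calc _ ≤ (Fintype.card F : ℝ)^2 * (3 * (Fintype.card F : ℝ) ^ 2) := by gcongr
    _ = _ := by ring

lemma klS_twist {F : Type*} [Field F] [Fintype F] [DecidableEq F] (ψ : AddChar F ℂ)
    (h k : F) (v : Fˣ) : klS ψ (h * v) (k * (v⁻¹ : Fˣ)) = klS ψ h k := by
  unfold klS
  rw [← Equiv.sum_comp (Equiv.mulLeft v) (fun u : Fˣ => ψ (h * u + k * (u⁻¹ : Fˣ)))]
  refine Finset.sum_congr rfl fun u _ => ?_
  congr 1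
  simp
  ring

lemma klS_prime {F : Type*} [Field F] [Fintype F] [DecidableEq F] (ψ : AddChar F ℂ)
    (hψ : ψ.IsPrimitive) (h k : F) (hk : h ≠ 0 ∨ k ≠ 0) :
    ‖klS ψ h k‖ ^ 4 * ((Fintype.card F : ℝ) - 1) ≤ 3 * (Fintype.card F : ℝ) ^ 4 := by
  refine le_trans ?_ (klS_moment ψ hψ)
  have hinj : Function.Injective (fun v : Fˣ => ((h * v, k * (v⁻¹ : Fˣ)) : F × F)) := by
    intro v w hvw
    simp only [Prod.mk.injEq] at hvw
    rcases hk with hk | hk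
    · exact Units.ext (mul_left_cancel₀ hk hvw.1)
    · exact inv_injective (Units.ext (mul_left_cancel₀ hk hvw.2))
  calc _ = ∑ v : Fˣ, ‖klS ψ (h * v) (k * (v⁻¹ : Fˣ))‖ ^ 4 := by
        simp only [klS_twist]
        rw [Finset.sum_const, Finset.card_univ, Fintype.card_units, nsmul_eq_mul,
          Nat.cast_sub Fintype.card_pos]
        push_cast
        ring
    _ = ∑ t ∈ Finset.univ.image (fun v : Fˣ => ((h * v, k * (v⁻¹ : Fˣ)) : F × F)), ‖klS ψ t.1 t.2‖ ^ 4 := by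
        rw [Finset.sum_image (fun a _ b _ hab => hinj hab)]
    _ ≤ _ := Finset.sum_le_sum_of_subset_of_nonneg (Finset.subset_univ _) (fun _ _ _ => by positivity)

lemma klS_norm_le {A : Type*} [CommRing A] [Fintype A] [DecidableEq A] (ψ : AddChar A ℂ) (h k : A) :
    ‖klS ψ h k‖ ≤ Fintype.card A := by
  unfold klS
  calc _ ≤ ∑ u : Aˣ, ‖ψ (h * u + k * (u⁻¹ : Aˣ))‖ := norm_sum_le _ _
    _ = Fintype.card Aˣ := by simp [AddChar.norm_apply]
    _ ≤ _ := by exact_mod_cast Fintype.card_le_of_injective _ Units.val_injective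

lemma klS_prod {A B C : Type*} [CommRing A] [Fintype A] [DecidableEq A] [CommRing B] [Fintype B] [DecidableEq B]
    [CommRing C] [Fintype C] [DecidableEq C] (e : C ≃+* A × B) (ψ : AddChar C ℂ) (h k : C) :
    klS ψ h k =
     klS (ψ.compAddMonoidHom ((e.symm : A × B →+ C).comp (AddMonoidHom.inl A B))) (e h).1 (e k).1 *
     klS (ψ.compAddMonoidHom ((e.symm : A × B →+ C).comp (AddMonoidHom.inr A B))) (e h).2 (e k).2 := by
  unfold klS
  rw [Finset.sum_mul_sum, ← Fintype.sum_prod_type']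
  rw [← Equiv.sum_comp ((Units.mapEquiv (e : C ≃* A × B)).trans MulEquiv.prodUnits).toEquiv]
  refine Finset.sum_congr rfl fun u _ => ?_
  simp only [AddChar.compAddMonoidHom_apply]
  rw [← AddChar.map_add_eq_mul]
  congr 1
  apply e.injective
  ext <;> simp <;> rfl

lemma klS_crt (p n : ℕ) [NeZero n] [NeZero (p * n)] (hp : p.Prime) (hc : p.Coprime n) (h k : ℤ)
    (hk : ¬ (p:ℤ) ∣ h ∨ ¬ (p:ℤ) ∣ k) :
    ‖klS (ZMod.stdAddChar (N := p * n)) (h : ZMod (p * n)) k‖ ^ 4 * ((p:ℝ) - 1) ≤ 3 * ((p * n : ℕ) : ℝ) ^ 4 := by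
  have : Fact p.Prime := ⟨hp⟩
  rw [klS_prod (ZMod.chineseRemainder hc), norm_mul, mul_pow]
  set ψ1 := (ZMod.stdAddChar (N := p * n)).compAddMonoidHom (((ZMod.chineseRemainder hc).symm : ZMod p × ZMod n →+ _).comp (AddMonoidHom.inl (ZMod p) (ZMod n))) with hψ1
  have hprim : ψ1.IsPrimitive := by
    apply AddChar.zmod_char_primitive_of_eq_one_only_at_zero
    intro a ha
    have : (ZMod.chineseRemainder hc).symm (a, 0) = 0 := by
      apply ZMod.injective_stdAddChar
      rw [AddChar.map_zero_eq_one]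
      simpa [hψ1] using ha
    rw [map_eq_zero_iff _ (ZMod.chineseRemainder hc).symm.injective] at this
    exact (Prod.ext_iff.1 this).1
  have h1 := klS_prime ψ1 hprim h k (by
    rcases hk with hk | hk
    · left; rwa [Ne, ZMod.intCast_zmod_eq_zero_iff_dvd]
    · right; rwa [Ne, ZMod.intCast_zmod_eq_zero_iff_dvd])
  rw [ZMod.card] at h1
  have h2 := klS_norm_le ((ZMod.stdAddChar (N := p * n)).compAddMonoidHom (((ZMod.chineseRemainder hc).symm : ZMod p × ZMod n →+ _).comp (AddMonoidHom.inr (ZMod p) (ZMod n)))) ((ZMod.chineseRemainder hc) h).2 ((ZMod.chineseRemainder hc) k).2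
  rw [ZMod.card] at h2
  have e1 : ((ZMod.chineseRemainder hc) (h : ZMod (p*n))).1 = h := by simp
  have e2 : ((ZMod.chineseRemainder hc) (k : ZMod (p*n))).1 = k := by simp
  rw [e1, e2]
  have h3 : (0:ℝ) ≤ p - 1 := by
    have := hp.one_lt.le
    have : (1:ℝ) ≤ p := by exact_mod_cast this
    linarith
  calc _ = (‖klS ψ1 h k‖ ^ 4 * ((p:ℝ) - 1)) * ‖klS ((ZMod.stdAddChar (N := p * n)).compAddMonoidHom (((ZMod.chineseRemainder hc).symm : ZMod p × ZMod n →+ _).comp (AddMonoidHom.inr (ZMod p) (ZMod n)))) ((ZMod.chineseRemainder hc) h).2 ((ZMod.chineseRemainder hc) k).2‖ ^ 4 := by ring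
    _ ≤ (3 * (p:ℝ) ^ 4) * (n:ℝ) ^ 4 := by gcongr
    _ = _ := by push_cast; ring

lemma klS_dvd (N p : ℕ) [NeZero N] (hp : p.Prime) (hd : p ∣ N) (hd2 : ¬ p ^ 2 ∣ N) (h k : ℤ)
    (hk : ¬ (p:ℤ) ∣ h ∨ ¬ (p:ℤ) ∣ k) :
    ‖klS (ZMod.stdAddChar (N := N)) (h : ZMod N) k‖ ^ 4 * ((p:ℝ) - 1) ≤ 3 * (N : ℝ) ^ 4 := by
  obtain ⟨n, rfl⟩ := hd
  have : NeZero n := ⟨fun h0 => NeZero.ne (p * n) (by simp [h0])⟩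
  apply klS_crt p n hp _ h k hk
  rw [hp.coprime_iff_not_dvd]
  intro hn
  exact hd2 (by rw [pow_two]; exact mul_dvd_mul_left p hn)

lemma exists_primes (P : ℕ) (ε : ℝ) (hε : 0 < ε) : ∃ S : Finset ℕ, (∀ p ∈ S, p.Prime ∧ P < p) ∧
    ∏ p ∈ S, (1 - 1 / (p:ℝ)) ≤ ε := by
  have h1 := (not_summable_iff_tendsto_nat_atTop_of_nonneg (f := Set.indicator {p : ℕ | p.Prime} (fun n : ℕ => (1:ℝ)/n)) (fun n => Set.indicator_nonneg (fun _ _ => by positivity) _)).1 not_summable_one_div_on_primes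
  obtain ⟨n, hn⟩ := (h1.eventually_ge_atTop ((P + 1 : ℝ) - Real.log ε)).exists
  refine ⟨(Finset.range n).filter (fun p => p.Prime ∧ P < p), by simp, ?_⟩
  have h2 : -Real.log ε ≤ ∑ p ∈ (Finset.range n).filter (fun p => p.Prime ∧ P < p), 1 / (p:ℝ) := by
    have : ∑ i ∈ Finset.range n, Set.indicator {p : ℕ | p.Prime} (fun n : ℕ => (1:ℝ)/n) i ≤
       ∑ p ∈ (Finset.range n).filter (fun p => p.Prime ∧ P < p), 1 / (p:ℝ) + ∑ p ∈ Finset.range (P+1), (1:ℝ) := by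
      calc _ ≤ ∑ i ∈ Finset.range n, ((if i.Prime ∧ P < i then 1 / (i:ℝ) else 0) + (if i ∈ Finset.range (P+1) then 1 else 0)) := by
            apply Finset.sum_le_sum
            intro i _
            by_cases hi : i.Prime
            · by_cases hP : P < i
              · simp [hi, hP, Set.indicator_apply]
                split_ifs <;> norm_num
              · have : (1:ℝ) ≤ i := by exact_mod_cast hi.one_lt.le
                simp [hi, hP, Set.indicator_apply, Nat.lt_succ_of_le (not_lt.1 hP)]
                exact inv_le_one_of_one_le₀ this
            · simp [hi, Set.indicator_apply]
              split_ifs <;> norm_num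
        _ ≤ _ := by
            rw [Finset.sum_add_distrib, Finset.sum_filter]
            gcongr
            rw [← Finset.sum_filter]
            apply Finset.sum_le_sum_of_subset_of_nonneg
            · intro x hx
              exact (Finset.mem_filter.1 hx).2
            · intros; norm_num
    simp only [Finset.sum_const, Finset.card_range, nsmul_eq_mul, mul_one] at this
    push_cast at this
    linarith
  calc _ ≤ ∏ p ∈ (Finset.range n).filter (fun p => p.Prime ∧ P < p), Real.exp (-(1 / (p:ℝ))) := by
        apply Finset.prod_le_prod
        · intro p hp
          have hp := (Finset.mem_filter.1 hp).2.1
          have : (1:ℝ) ≤ p := by exact_mod_cast hp.one_lt.le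
          have := div_le_one_of_le₀ this (by linarith)
          linarith
        · intro p hp
          have := Real.add_one_le_exp (-(1/(p:ℝ)))
          linarith
    _ = Real.exp (- ∑ p ∈ (Finset.range n).filter (fun p => p.Prime ∧ P < p), 1 / (p:ℝ)) := by
        rw [← Real.exp_sum, Finset.sum_neg_distrib]
    _ ≤ Real.exp (Real.log ε) := by
        gcongr
        linarith
    _ = ε := Real.exp_log hε

lemma totient_prod (S : Finset ℕ) (hS : ∀ p ∈ S, p.Prime) :
    ((∏ p ∈ S, p).totient : ℝ) = (∏ p ∈ S, p : ℕ) * ∏ p ∈ S, (1 - 1 / (p:ℝ)) := by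
  induction S using Finset.induction_on with
  | empty => simp
  | insert a s ha ih =>
    have hpa := hS a (by simp)
    rw [Finset.prod_insert ha, Finset.prod_insert ha, Nat.totient_mul, Nat.totient_prime hpa]
    · push_cast
      rw [ih (fun p hp => hS p (by simp [hp])), Nat.cast_sub hpa.one_lt.le]
      have : (a:ℝ) ≠ 0 := by exact_mod_cast hpa.ne_zero
      push_cast
      field_simp
    · apply Nat.Coprime.prod_right
      intro i hi
      rw [Nat.coprime_primes hpa (hS i (by simp [hi]))]
      rintro rfl
      exact ha hi

lemma klS_sum_bound (h k : ℤ) (hk : h ≠ 0 ∨ k ≠ 0) (ε : ℝ) (hε : 0 < ε) :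
    ∃ M : ℝ, ∀ X : ℕ, ∑ a ∈ Finset.range X, ‖klS (ZMod.stdAddChar (N := a + 1)) (h : ZMod (a + 1)) k‖ ≤
      ε * X ^ 2 + M * X := by
  set δ := ε / 3 with hδ
  have hδ0 : 0 < δ := by positivity
  obtain ⟨P, hP⟩ := exists_nat_gt (max (max (2/δ) (3/δ^4)) (max (|h| : ℝ) |k|))
  simp only [max_lt_iff] at hP
  obtain ⟨⟨hP1, hP2⟩, hP3, hP4⟩ := hP
  obtain ⟨S, hS, hprod⟩ := exists_primes P δ hδ0
  set M := ∏ p ∈ S, p with hM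
  have hM0 : M ≠ 0 := Finset.prod_ne_zero_iff.2 fun p hp => (hS p hp).1.ne_zero
  refine ⟨M, fun X => ?_⟩
  have hpt : ∀ a ∈ Finset.range X, ‖klS (ZMod.stdAddChar (N := a + 1)) (h : ZMod (a + 1)) k‖ ≤
      X * (if M.Coprime (a+1) then 1 else 0) + X * (∑ p ∈ S, if p^2 ∣ a + 1 then 1 else 0) + δ * X := by
    intro a ha
    have haX : ((a + 1 : ℕ) : ℝ) ≤ X := by exact_mod_cast Finset.mem_range.1 ha
    have htriv := klS_norm_le (ZMod.stdAddChar (N := a + 1)) (h : ZMod (a + 1)) k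
    rw [ZMod.card] at htriv
    have hsum0 : (0:ℝ) ≤ ∑ p ∈ S, if p^2 ∣ a + 1 then 1 else 0 := Finset.sum_nonneg fun p _ => by split_ifs <;> norm_num
    by_cases hc : M.Coprime (a+1)
    · rw [if_pos hc]
      have : (0:ℝ) ≤ X * ∑ p ∈ S, (if p^2 ∣ a + 1 then (1:ℝ) else 0) := by positivity
      have : 0 ≤ δ * X := by positivity
      linarith
    · by_cases hsq : ∃ p ∈ S, p^2 ∣ a + 1
      · obtain ⟨p, hp, hpd⟩ := hsq
        have : (1:ℝ) ≤ ∑ p ∈ S, (if p^2 ∣ a + 1 then (1:ℝ) else 0) := by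
          calc (1:ℝ) = if p^2 ∣ a + 1 then (1:ℝ) else 0 := by simp [hpd]
            _ ≤ _ := Finset.single_le_sum (f := fun p => if p^2 ∣ a + 1 then (1:ℝ) else 0) (fun p _ => by split_ifs <;> norm_num) hp
        have h1 : (X:ℝ) * 1 ≤ X * ∑ p ∈ S, (if p^2 ∣ a + 1 then (1:ℝ) else 0) := by gcongr
        have : 0 ≤ δ * X := by positivity
        rw [if_neg hc]
        linarith
      · push Not at hsq
        have : ∃ p ∈ S, p ∣ a + 1 := by
          by_contra hcon
          push Not at hcon
          apply hc
          apply Nat.Coprime.prod_left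
          intro p hp
          exact ((hS p hp).1.coprime_iff_not_dvd).2 (hcon p hp)
        obtain ⟨p, hp, hpd⟩ := this
        obtain ⟨hpp, hpP⟩ := hS p hp
        have hpPr : (P:ℝ) + 1 ≤ p := by exact_mod_cast hpP
        have hnd : ∀ m : ℤ, m ≠ 0 → (|m| : ℝ) < P → ¬ (p:ℤ) ∣ m := by
          intro m hm hlt hd
          have h1 := Int.le_of_dvd (abs_pos.2 hm) ((dvd_abs _ _).2 hd)
          have h2 : (p:ℝ) ≤ (|m| : ℝ) := by exact_mod_cast h1
          linarith
        have hb := klS_dvd (a+1) p hpp hpd (hsq p hp) h k (by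
          rcases hk with hk | hk
          · left; exact hnd h hk hP3
          · right; exact hnd k hk hP4)
        have hle : ‖klS (ZMod.stdAddChar (N := a + 1)) (h : ZMod (a + 1)) k‖ ≤ δ * ((a + 1 : ℕ) : ℝ) := by
          apply le_of_pow_le_pow_left₀ (n := 4) (by norm_num) (by positivity)
          have h3 : 3 < δ^4 * ((p:ℝ) - 1) := by
            rw [div_lt_iff₀ (by positivity)] at hP2
            nlinarith [pow_pos hδ0 4]
          have hp0 : (0:ℝ) < (p:ℝ) - 1 := by
            have : (0:ℝ) ≤ P := by positivity
            have := hpp.one_lt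
            have : (1:ℝ) < p := by exact_mod_cast this
            linarith
          rw [mul_pow]
          have h4 : 3 * ((a + 1 : ℕ) : ℝ) ^ 4 ≤ (δ^4 * ((p:ℝ) - 1)) * ((a + 1 : ℕ) : ℝ) ^ 4 := by gcongr
          apply le_of_mul_le_mul_right _ hp0
          linarith
        have : δ * ((a + 1 : ℕ) : ℝ) ≤ δ * X := by gcongr
        have : (0:ℝ) ≤ X * ∑ p ∈ S, (if p^2 ∣ a + 1 then (1:ℝ) else 0) := by positivity
        rw [if_neg hc]
        linarith
  refine (Finset.sum_le_sum hpt).trans ?_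
  rw [Finset.sum_add_distrib, Finset.sum_add_distrib, ← Finset.mul_sum, ← Finset.mul_sum, Finset.sum_comm]
  have c1 : ∑ a ∈ Finset.range X, (if M.Coprime (a+1) then (1:ℝ) else 0) ≤ δ * X + M := by
    have h1 := Nat.Ico_filter_coprime_le (a := M) 1 X hM0
    have h2 : ∑ a ∈ Finset.range X, (if M.Coprime (a+1) then (1:ℝ) else 0) = ((Finset.Ico 1 (1 + X)).filter (M.Coprime)).card := by
      rw [Finset.card_filter, Finset.sum_Ico_eq_sum_range]
      push_cast
      simp [add_comm]
    rw [h2]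
    have h3 : (M.totient : ℝ) ≤ M * δ := by
      rw [hM, totient_prod S (fun p hp => (hS p hp).1)]
      gcongr
    have h5 : (M.totient : ℝ) ≤ M := by exact_mod_cast Nat.totient_le M
    have hMr : (0:ℝ) < M := by exact_mod_cast Nat.pos_of_ne_zero hM0
    calc _ ≤ ((M.totient * (X / M + 1) : ℕ) : ℝ) := by exact_mod_cast h1
      _ = M.totient * ((X / M : ℕ) : ℝ) + M.totient := by push_cast; ring
      _ ≤ (M * δ) * ((X:ℝ) / M) + M := by
          gcongr
          exact Nat.cast_div_le
      _ = _ := by field_simp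
  have c2 : ∑ p ∈ S, ∑ a ∈ Finset.range X, (if p^2 ∣ a + 1 then (1:ℝ) else 0) ≤ δ * X := by
    have h1 : ∀ p ∈ S, ∑ a ∈ Finset.range X, (if p^2 ∣ a + 1 then (1:ℝ) else 0) ≤ X * ((p:ℝ)^2)⁻¹ := by
      intro p hp
      have := Nat.card_multiples X (p^2)
      rw [Finset.card_filter] at this
      have h2 : ∑ a ∈ Finset.range X, (if p^2 ∣ a + 1 then (1:ℝ) else 0) = ((X / p^2 : ℕ) : ℝ) := by
        rw [← this]; push_cast; rfl
      rw [h2]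
      refine Nat.cast_div_le.trans ?_
      push_cast
      rw [div_eq_mul_inv]
    refine (Finset.sum_le_sum h1).trans ?_
    rw [← Finset.mul_sum, mul_comm]
    gcongr
    calc ∑ p ∈ S, ((p:ℝ)^2)⁻¹ ≤ ∑ p ∈ Finset.Ioo P (S.sup id + 1), ((p:ℝ)^2)⁻¹ := by
          apply Finset.sum_le_sum_of_subset_of_nonneg
          · intro p hp
            simp only [Finset.mem_Ioo]
            exact ⟨(hS p hp).2, Nat.lt_succ_of_le (Finset.le_sup (f := id) hp)⟩
          · intros; positivity
      _ ≤ 2 / ((P:ℝ) + 1) := sum_Ioo_inv_sq_le _ _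
      _ ≤ δ := by
          rw [div_lt_iff₀ hδ0] at hP1
          rw [div_le_iff₀ (by positivity)]
          nlinarith
  rw [Finset.sum_const, Finset.card_range, nsmul_eq_mul]
  have hX : (0:ℝ) ≤ X := by positivity
  have := mul_le_mul_of_nonneg_left c1 hX
  have := mul_le_mul_of_nonneg_left c2 hX
  have e : ε = 3 * δ := by rw [hδ]; ring
  rw [e]
  nlinarith

open ArithmeticFunction in
lemma totient_conv (n : ℕ) :
    (((ArithmeticFunction.moebius : ArithmeticFunction ℤ) : ArithmeticFunction ℝ) *
      ((ArithmeticFunction.id : ArithmeticFunction ℕ) : ArithmeticFunction ℝ)) n = (n.totient : ℝ) := by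
  rcases Nat.eq_zero_or_pos n with rfl | hn
  · simp
  have h := (ArithmeticFunction.sum_eq_iff_sum_mul_moebius_eq (R := ℝ) (f := fun n => (n.totient:ℝ)) (g := fun n => (n:ℝ))).1 (fun n _ => by
    exact_mod_cast Nat.sum_totient n) n hn
  rw [← h, ArithmeticFunction.mul_apply]
  rfl

lemma sum_moebius_sq : ∑' d : ℕ, ((ArithmeticFunction.moebius d : ℤ) : ℝ) * (1 / (2 * (d:ℝ)^2)) = 3 / Real.pi ^ 2 := by
  have h1 := LSeries_one_mul_Lseries_moebius (s := 2) (by norm_num)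
  rw [LSeries_one_eq_riemannZeta (by norm_num), riemannZeta_two] at h1
  have h2 : LSeries (fun n => ((ArithmeticFunction.moebius n : ℤ) : ℂ)) 2 = ((∑' d : ℕ, ((ArithmeticFunction.moebius d : ℤ) : ℝ) * (1 / ((d:ℝ)^2)) : ℝ) : ℂ) := by
    rw [LSeries, Complex.ofReal_tsum]
    congr 1
    ext d
    rcases eq_or_ne d 0 with rfl | hd
    · simp
    · rw [LSeries.term_of_ne_zero hd]
      push_cast
      rw [show (2:ℂ) = ((2:ℕ):ℂ) by norm_num, Complex.cpow_natCast]
      ring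
  rw [h2] at h1
  have h3 : (Real.pi^2/6) * (∑' d : ℕ, ((ArithmeticFunction.moebius d : ℤ) : ℝ) * (1 / ((d:ℝ)^2))) = 1 := by
    exact_mod_cast h1
  have h4 : ∑' d : ℕ, ((ArithmeticFunction.moebius d : ℤ) : ℝ) * (1 / (2 * (d:ℝ)^2)) =
     (1/2) * ∑' d : ℕ, ((ArithmeticFunction.moebius d : ℤ) : ℝ) * (1 / ((d:ℝ)^2)) := by
    rw [← tsum_mul_left]
    congr 1
    ext d
    rw [one_div, mul_inv]
    ring
  rw [h4]
  have hpi := Real.pi_pos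
  rw [eq_div_iff (by positivity)]
  linear_combination 3 * h3

lemma sum_Ioc_id (k : ℕ) : ∑ m ∈ Finset.Ioc 0 k, (m:ℝ) = k * (k + 1) / 2 := by
  induction k with
  | zero => simp
  | succ n ih => rw [Finset.sum_Ioc_succ_top (by omega), ih]; push_cast; ring

lemma totient_sum (X : ℕ) : ∑ a ∈ Finset.range X, ((a+1).totient : ℝ) =
    ∑' d : ℕ, ((ArithmeticFunction.moebius d : ℤ) : ℝ) * (((X / d : ℕ) : ℝ) * ((X / d : ℕ) + 1) / 2) := by
  have h1 := ArithmeticFunction.sum_Ioc_mul_eq_sum_sum ((ArithmeticFunction.moebius : ArithmeticFunction ℤ) : ArithmeticFunction ℝ) ((ArithmeticFunction.id : ArithmeticFunction ℕ) : ArithmeticFunction ℝ) X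
  simp only [totient_conv] at h1
  rw [tsum_eq_sum (s := Finset.Ioc 0 X)]
  · rw [Finset.range_eq_Ico, Finset.sum_Ico_add' (fun a => (a.totient:ℝ)) 0 X 1]
    have : Finset.Ico (0+1) (X+1) = Finset.Ioc 0 X := by ext; simp; omega
    rw [this, h1]
    refine Finset.sum_congr rfl fun d _ => ?_
    rw [← sum_Ioc_id]
    rfl
  · intro d hd
    have : X / d = 0 := by
      simp only [Finset.mem_Ioc, not_and_or, not_lt, not_le] at hd
      rcases hd with h | h
      · simp [Nat.le_zero.1 h]
      · exact Nat.div_eq_of_lt h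
    simp [this]

lemma totient_asymp : Tendsto (fun X : ℕ => (∑ a ∈ Finset.range X, ((a+1).totient : ℝ)) / (X:ℝ)^2) atTop (nhds (3 / Real.pi ^ 2)) := by
  rw [← sum_moebius_sq]
  simp_rw [totient_sum, ← tsum_div_const]
  have hs : Summable (fun d : ℕ => 1 / (d:ℝ)^2) := Real.summable_one_div_nat_pow.2 (by norm_num)
  apply tendsto_tsum_of_dominated_convergence hs
  · intro d
    have ht : Tendsto (fun X : ℕ => ((X / d : ℕ) : ℝ) / X) atTop (nhds (1 / (d:ℝ))) := by
      rcases Nat.eq_zero_or_pos d with rfl | hd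
      · simp
      have := (tendsto_nat_floor_mul_div_atTop (R := ℝ) (a := 1/(d:ℝ)) (by positivity)).comp (tendsto_natCast_atTop_atTop (R := ℝ))
      refine this.congr fun X => ?_
      simp only [Function.comp]
      congr 2
      rw [← Nat.floor_div_eq_div (K := ℝ)]
      congr 1
      ring
    have h2 : Tendsto (fun X : ℕ => ((ArithmeticFunction.moebius d : ℤ) : ℝ) * ((((X / d : ℕ) : ℝ) / X) * ((((X / d : ℕ) : ℝ) / X) + 1 / (X:ℝ)) / 2)) atTop (nhds (((ArithmeticFunction.moebius d : ℤ) : ℝ) * ((1/(d:ℝ)) * ((1/(d:ℝ)) + 0) / 2))) := by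
      exact ((ht.mul (ht.add tendsto_one_div_atTop_nhds_zero_nat)).div_const 2).const_mul _
    have e : ((ArithmeticFunction.moebius d : ℤ) : ℝ) * ((1/(d:ℝ)) * ((1/(d:ℝ)) + 0) / 2) = ((ArithmeticFunction.moebius d : ℤ) : ℝ) * (1 / (2 * (d:ℝ)^2)) := by
      rw [add_zero, one_div, one_div, mul_inv, ← inv_pow]; ring
    rw [← e]
    refine h2.congr fun X => ?_
    rcases Nat.eq_zero_or_pos X with rfl | hX
    · simp
    have : (X:ℝ) ≠ 0 := by positivity
    field_simp
  · filter_upwards [eventually_gt_atTop 0] with X hX d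
    have hX' : (0:ℝ) < X := by exact_mod_cast hX
    have hμ : |((ArithmeticFunction.moebius d : ℤ) : ℝ)| ≤ 1 := by exact_mod_cast ArithmeticFunction.abs_moebius_le_one
    set q : ℝ := ((X / d : ℕ) : ℝ) with hq
    have hq0 : 0 ≤ q := by positivity
    have hq1 : q ≤ X / d := Nat.cast_div_le
    have hqq : q ≤ q^2 := by
      have : X / d ≤ (X / d)^2 := Nat.le_self_pow (by norm_num) _
      rw [hq]; exact_mod_cast this
    rw [Real.norm_eq_abs, abs_div, abs_mul, abs_of_nonneg (a := (X:ℝ)^2) (by positivity), abs_of_nonneg (a := q * (q+1)/2) (by positivity)]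
    rw [div_le_iff₀ (by positivity)]
    calc _ ≤ 1 * (q^2) := by
          gcongr
          nlinarith
      _ ≤ (X/d)^2 := by rw [one_mul]; gcongr
      _ = _ := by rw [div_pow]; ring

lemma dense_extend (T : ℕ → C(UnitAddCircle, ℂ) →ₗ[ℂ] ℂ) (L : C(UnitAddCircle, ℂ) →ₗ[ℂ] ℂ) (C : ℝ)
    (hT : ∀ X f, ‖T X f‖ ≤ C * ‖f‖) (hL : ∀ f, ‖L f‖ ≤ C * ‖f‖)
    (hf : ∀ n : ℤ, Tendsto (fun X => T X (fourier n)) atTop (nhds (L (fourier n)))) (f : C(UnitAddCircle, ℂ)) :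
    Tendsto (fun X => T X f) atTop (nhds (L f)) := by
  have hspan : ∀ g ∈ Submodule.span ℂ (Set.range (@fourier 1)), Tendsto (fun X => T X g) atTop (nhds (L g)) := by
    intro g hg
    induction hg using Submodule.span_induction with
    | mem x hx => obtain ⟨n, rfl⟩ := hx; exact hf n
    | zero => simp
    | add x y _ _ hx hy => simpa only [map_add] using hx.add hy
    | smul a x _ hx => simpa only [map_smul] using hx.const_smul a
  have hmem : f ∈ (Submodule.span ℂ (Set.range (@fourier 1))).topologicalClosure := by
    rw [span_fourier_closure_eq_top]; trivial
  have hC : 0 ≤ C := by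
    have := (norm_nonneg _).trans (hL 1)
    simpa using this
  rw [Metric.tendsto_atTop]
  intro ε hε
  have hd : 0 < ε / (3 * (C + 1)) := by positivity
  obtain ⟨g, hg, hfg⟩ := Metric.mem_closure_iff.1 hmem _ hd
  obtain ⟨N, hN⟩ := Metric.tendsto_atTop.1 (hspan g hg) (ε / 3) (by positivity)
  refine ⟨N, fun X hX => ?_⟩
  have h1 := hN X hX
  rw [dist_eq_norm] at h1 hfg ⊢
  have h2 : T X f - L f = T X (f - g) + (T X g - L g) - L (f - g) := by
    simp only [map_sub]; ring
  have h3 : C * ‖f - g‖ < ε / 3 := by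
    rw [lt_div_iff₀ (by positivity)] at hfg
    have := norm_nonneg (f - g)
    nlinarith
  rw [h2]
  calc _ ≤ ‖T X (f - g) + (T X g - L g)‖ + ‖L (f - g)‖ := norm_sub_le _ _
    _ ≤ ‖T X (f - g)‖ + ‖T X g - L g‖ + ‖L (f - g)‖ := by gcongr; exact norm_add_le _ _
    _ < ε := by
      have := hT X (f - g)
      have := hL (f - g)
      linarith

/-- Averages over inverse pairs. -/
noncomputable def lam (X : ℕ) (f g : UnitAddCircle → ℂ) : ℂ :=
  (∑ a ∈ Finset.range X, ∑ u : (ZMod (a+1))ˣ, f (ZMod.toAddCircle (u : ZMod (a+1))) *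
    g (ZMod.toAddCircle (-((u⁻¹ : (ZMod (a+1))ˣ) : ZMod (a+1))))) / (X:ℂ)^2

lemma lam_bound (X : ℕ) (f g : C(UnitAddCircle, ℂ)) : ‖lam X f g‖ ≤ ‖f‖ * ‖g‖ := by
  rw [lam, norm_div, norm_pow, Complex.norm_natCast]
  apply div_le_of_le_mul₀ (by positivity) (by positivity)
  calc _ ≤ ∑ a ∈ Finset.range X, ∑ u : (ZMod (a+1))ˣ, ‖f‖ * ‖g‖ := by
        refine (norm_sum_le _ _).trans (Finset.sum_le_sum fun a _ => ?_)
        refine (norm_sum_le _ _).trans (Finset.sum_le_sum fun u _ => ?_)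
        rw [norm_mul]
        gcongr
        · exact f.norm_coe_le_norm _
        · exact g.norm_coe_le_norm _
    _ ≤ ∑ a ∈ Finset.range X, X * (‖f‖ * ‖g‖) := by
        refine Finset.sum_le_sum fun a ha => ?_
        rw [Finset.sum_const, nsmul_eq_mul, Finset.card_univ, ZMod.card_units_eq_totient]
        have : (a+1).totient ≤ X := (Nat.totient_le _).trans (Finset.mem_range.1 ha)
        gcongr
    _ = _ := by rw [Finset.sum_const, Finset.card_range, nsmul_eq_mul]; ring

lemma fourier_toAddCircle (N : ℕ) [NeZero N] (h : ℤ) (u : ZMod N) :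
    (fourier h (ZMod.toAddCircle u) : ℂ) = ZMod.stdAddChar ((h : ZMod N) * u) := by
  rw [fourier_apply, ← map_zsmul, zsmul_eq_mul]
  rfl

lemma lam_fourier (h k : ℤ) : Tendsto (fun X => lam X (fourier h) (fourier k)) atTop
    (nhds (if h = 0 ∧ k = 0 then ((3 / Real.pi ^ 2 : ℝ) : ℂ) else 0)) := by
  split_ifs with hk
  · obtain ⟨rfl, rfl⟩ := hk
    have h1 := (Complex.continuous_ofReal.tendsto _).comp totient_asymp
    refine h1.congr fun X => ?_
    simp [lam, ZMod.card_units_eq_totient]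
  · rw [tendsto_zero_iff_norm_tendsto_zero, Metric.tendsto_atTop]
    intro ε hε
    obtain ⟨M, hM⟩ := klS_sum_bound h (-k) (by
      rw [not_and_or] at hk
      rcases hk with hk | hk
      · exact Or.inl hk
      · exact Or.inr (neg_ne_zero.2 hk)) (ε / 2) (by positivity)
    obtain ⟨N, hN⟩ := exists_nat_gt (2 * M / ε)
    refine ⟨N + 1, fun X hX => ?_⟩
    rw [Real.dist_eq, sub_zero, abs_of_nonneg (norm_nonneg _), lam, norm_div, norm_pow, Complex.norm_natCast]
    have hX0 : (0:ℝ) < X := by exact_mod_cast (by omega : 0 < X)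
    have hXN : (N:ℝ) ≤ X := by exact_mod_cast (by omega : N ≤ X)
    rw [div_lt_iff₀ (by positivity)]
    rw [div_lt_iff₀ hε] at hN
    have h2 : ∑ a ∈ Finset.range X, ∑ u : (ZMod (a+1))ˣ, (fourier h (ZMod.toAddCircle (u : ZMod (a+1))) : ℂ) *
      fourier k (ZMod.toAddCircle (-((u⁻¹ : (ZMod (a+1))ˣ) : ZMod (a+1)))) =
      ∑ a ∈ Finset.range X, klS (ZMod.stdAddChar (N := a + 1)) (h : ZMod (a + 1)) (-k : ℤ) := by
      refine Finset.sum_congr rfl fun a _ => ?_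
      unfold klS
      refine Finset.sum_congr rfl fun u _ => ?_
      rw [fourier_toAddCircle, fourier_toAddCircle, ← AddChar.map_add_eq_mul]
      congr 1
      push_cast
      ring
    rw [h2]
    refine (norm_sum_le _ _).trans_lt ((hM X).trans_lt ?_)
    have h5 : N * ε ≤ X * ε := by gcongr
    have h6 : 0 < (X * ε - 2 * M) * X := mul_pos (by linarith) hX0
    nlinarith

lemma lam_add_left (X : ℕ) (f f' g : UnitAddCircle → ℂ) : lam X (f + f') g = lam X f g + lam X f' g := by
  simp [lam, add_mul, Finset.sum_add_distrib, add_div]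

lemma lam_smul_left (X : ℕ) (c : ℂ) (f g : UnitAddCircle → ℂ) : lam X (c • f) g = c * lam X f g := by
  simp only [lam, Pi.smul_apply, smul_eq_mul, mul_assoc, ← Finset.mul_sum]
  rw [mul_div_assoc]

lemma lam_add_right (X : ℕ) (f g g' : UnitAddCircle → ℂ) : lam X f (g + g') = lam X f g + lam X f g' := by
  simp [lam, mul_add, Finset.sum_add_distrib, add_div]

lemma lam_smul_right (X : ℕ) (c : ℂ) (f g : UnitAddCircle → ℂ) : lam X f (c • g) = c * lam X f g := by
  simp only [lam, Pi.smul_apply, smul_eq_mul, mul_left_comm, ← Finset.mul_sum]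
  rw [mul_div_assoc]

/-- Integral functional. -/
noncomputable def intL : C(UnitAddCircle, ℂ) →ₗ[ℂ] ℂ where
  toFun f := ∫ x, f x ∂(AddCircle.haarAddCircle (T := 1))
  map_add' f g := by
    simp only [ContinuousMap.add_apply]
    exact MeasureTheory.integral_add (f.continuous.integrable_of_hasCompactSupport (HasCompactSupport.of_compactSpace _)) (g.continuous.integrable_of_hasCompactSupport (HasCompactSupport.of_compactSpace _))
  map_smul' c f := by
    simp only [ContinuousMap.smul_apply, RingHom.id_apply]
    exact MeasureTheory.integral_smul c _

lemma intL_bound (f : C(UnitAddCircle, ℂ)) : ‖intL f‖ ≤ ‖f‖ := by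
  have := MeasureTheory.norm_integral_le_of_norm_le_const (μ := AddCircle.haarAddCircle (T := 1)) (f := f) (C := ‖f‖) (Filter.Eventually.of_forall fun x => f.norm_coe_le_norm x)
  simpa [intL] using this

lemma intL_fourier (n : ℤ) : intL (fourier n) = if n = 0 then 1 else 0 := by
  have h1 := congrFun (fourierCoeff_fourier (T := 1) n) 0
  simp only [fourierCoeff, neg_zero, Pi.single_apply] at h1
  simp only [fourier_zero, one_smul] at h1
  change ∫ x, fourier n x ∂_ = _
  rw [h1]
  simp [eq_comm]

lemma lam_tendsto (f g : C(UnitAddCircle, ℂ)) : Tendsto (fun X => lam X f g) atTop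
    (nhds (((3 / Real.pi ^ 2 : ℝ) : ℂ) * intL f * intL g)) := by
  set c : ℂ := ((3 / Real.pi ^ 2 : ℝ) : ℂ) with hc
  have step1 : ∀ h : ℤ, Tendsto (fun X => lam X (fourier h) g) atTop (nhds (c * intL (fourier h) * intL g)) := by
    intro h
    apply dense_extend (fun X => { toFun := fun g => lam X (fourier h) g, map_add' := fun f g => lam_add_right X _ f g, map_smul' := fun c f => lam_smul_right X c _ f }) ((c * intL (fourier h)) • intL) (1 + ‖c‖)
    · intro X f
      refine (lam_bound X (fourier h) f).trans ?_
      have := fourier_norm (T := 1) h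
      rw [this]
      gcongr
      linarith [norm_nonneg c]
    · intro f
      simp only [LinearMap.smul_apply, smul_eq_mul, norm_mul]
      have := intL_bound (fourier h)
      rw [fourier_norm (T := 1) h] at this
      calc _ ≤ ‖c‖ * 1 * ‖f‖ := by gcongr; exact intL_bound f
        _ ≤ _ := by gcongr; linarith
    · intro k
      have := lam_fourier h k
      simp only [LinearMap.smul_apply, smul_eq_mul, intL_fourier]
      have e : ((c * if h = 0 then 1 else 0) * if k = 0 then 1 else 0) = if h = 0 ∧ k = 0 then ((3 / Real.pi ^ 2 : ℝ) : ℂ) else 0 := by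
        by_cases h1 : h = 0 <;> by_cases h2 : k = 0 <;> simp [h1, h2, hc]
      rw [e]
      exact this
  have := dense_extend (fun X => { toFun := fun f => lam X f g, map_add' := fun f f' => lam_add_left X f f' g, map_smul' := fun c f => lam_smul_left X c f g }) ((c * intL g) • intL) ((1 + ‖c‖) * ‖g‖) ?_ ?_ ?_ f
  · simp only [LinearMap.smul_apply, smul_eq_mul] at this
    rw [mul_right_comm]
    exact this
  · intro X f
    refine (lam_bound X f g).trans ?_
    have : 0 ≤ ‖c‖ * (‖f‖ * ‖g‖) := by positivity
    nlinarith
  · intro f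
    simp only [LinearMap.smul_apply, smul_eq_mul, norm_mul]
    calc _ ≤ ‖c‖ * ‖g‖ * ‖f‖ := by gcongr; exact intL_bound g; exact intL_bound f
        _ ≤ _ := by gcongr; linarith
  · intro h
    have := step1 h
    simp only [LinearMap.smul_apply, smul_eq_mul]
    rw [mul_right_comm]
    exact this

/-- Trapezoidal bump on the circle. -/
noncomputable def bump (x0 r δ : ℝ) (x : UnitAddCircle) : ℝ :=
  max 0 (min 1 (1 - (‖x - (x0 : UnitAddCircle)‖ - r) / δ))

lemma bump_nonneg (x0 r δ : ℝ) (x : UnitAddCircle) : 0 ≤ bump x0 r δ x := le_max_left _ _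

lemma bump_cont (x0 r δ : ℝ) : Continuous (bump x0 r δ) := by
  unfold bump
  fun_prop

lemma bump_one (x0 r δ : ℝ) (hδ : 0 < δ) (x : UnitAddCircle) (hx : ‖x - (x0 : UnitAddCircle)‖ ≤ r) :
    1 ≤ bump x0 r δ x := by
  unfold bump
  have : (‖x - (x0 : UnitAddCircle)‖ - r) / δ ≤ 0 := div_nonpos_of_nonpos_of_nonneg (by linarith) hδ.le
  rw [le_max_iff]
  right
  rw [le_min_iff]
  exact ⟨le_rfl, by linarith⟩

/-- The bump as a complex continuous map. -/
noncomputable def bumpC (x0 r δ : ℝ) : C(UnitAddCircle, ℂ) :=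
  ⟨fun x => (bump x0 r δ x : ℂ), by have := bump_cont x0 r δ; fun_prop⟩

lemma bump_int (x0 r δ : ℝ) (hr : 0 ≤ r) (hδ : 0 < δ) : ∃ t : ℝ, intL (bumpC x0 r δ) = t ∧ 0 ≤ t ∧ t ≤ 2 * (r + δ) := by
  refine ⟨∫ x, bump x0 r δ x ∂(AddCircle.haarAddCircle (T := 1)), ?_, ?_, ?_⟩
  · change ∫ x, (bump x0 r δ x : ℂ) ∂(AddCircle.haarAddCircle (T := 1)) = _
    exact integral_ofReal
  · exact MeasureTheory.integral_nonneg fun x => bump_nonneg _ _ _ _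
  · have hvol : (AddCircle.haarAddCircle (T := 1)) = MeasureTheory.volume := by
      rw [AddCircle.volume_eq_smul_haarAddCircle]; simp
    rw [hvol]
    calc _ ≤ ∫ x : UnitAddCircle, (Metric.closedBall (x0 : UnitAddCircle) (r + δ)).indicator (fun _ => (1:ℝ)) x := by
          apply MeasureTheory.integral_mono
          · exact (bump_cont x0 r δ).integrable_of_hasCompactSupport (HasCompactSupport.of_compactSpace _)
          · exact (MeasureTheory.integrable_const _).indicator measurableSet_closedBall
          · intro x
            by_cases h : x ∈ Metric.closedBall (x0 : UnitAddCircle) (r + δ)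
            · rw [Set.indicator_of_mem h]
              exact max_le zero_le_one (min_le_left _ _)
            · rw [Set.indicator_of_notMem h]
              rw [Metric.mem_closedBall, dist_eq_norm, not_le] at h
              have : 1 ≤ (‖x - (x0 : UnitAddCircle)‖ - r) / δ := by
                rw [le_div_iff₀ hδ]; linarith
              exact max_le le_rfl ((min_le_right _ _).trans (by linarith))
      _ = (MeasureTheory.volume (Metric.closedBall (x0 : UnitAddCircle) (r + δ))).toReal := by
          rw [MeasureTheory.integral_indicator measurableSet_closedBall]
          simp [MeasureTheory.Measure.real]
      _ = min 1 (2 * (r + δ)) := by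
          rw [AddCircle.volume_closedBall, ENNReal.toReal_ofReal]
          positivity
      _ ≤ _ := min_le_right _ _

/-- Units whose pair lies in a given box. -/
def boxSet (m i j N : ℕ) [NeZero N] : Finset (ZMod N)ˣ :=
  Finset.univ.filter (fun u => m * (u : ZMod N).val / N = i ∧ m * (-((u⁻¹ : (ZMod N)ˣ) : ZMod N)).val / N = j)

/-- Cumulative box count. -/
def boxT (m i j X : ℕ) : ℕ := ∑ a ∈ Finset.range X, (boxSet m i j (a+1)).card

lemma box_norm (m i N b : ℕ) (hm : 0 < m) (hN : 0 < N) (h : m * b / N = i) :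
    ‖(((b / N : ℝ)) : UnitAddCircle) - (((2 * i + 1) / (2 * m) : ℝ) : UnitAddCircle)‖ ≤ 1 / (2 * m) := by
  have h1 : i * N ≤ m * b := by rw [← h]; exact Nat.div_mul_le_self _ _
  have h2 : m * b < (i + 1) * N := by rw [← Nat.div_lt_iff_lt_mul hN, h]; exact Nat.lt_succ_self i
  have h1' : (i:ℝ) * N ≤ m * b := by exact_mod_cast h1
  have h2' : (m:ℝ) * b < (i + 1) * N := by exact_mod_cast h2
  have hm' : (0:ℝ) < m := by exact_mod_cast hm
  have hN' : (0:ℝ) < N := by exact_mod_cast hN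
  rw [← AddCircle.coe_sub, UnitAddCircle.norm_eq]
  refine (round_le _ 0).trans ?_
  rw [Int.cast_zero, sub_zero]
  have e : (b / N : ℝ) - (2 * i + 1) / (2 * m) = (2 * (m * b) - (2 * i + 1) * N) / (N * (2 * m)) := by
    field_simp
  rw [e, abs_div, abs_of_pos (a := (N:ℝ) * (2*m)) (by positivity), div_le_div_iff₀ (by positivity) (by positivity)]
  have : |2 * ((m:ℝ) * b) - (2 * i + 1) * N| ≤ N := by
    rw [abs_le]; constructor <;> linarith
  nlinarith

lemma box_upper (m i j X : ℕ) (hm : 0 < m) (δ : ℝ) (hδ : 0 < δ) :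
    (boxT m i j X : ℝ) / X^2 ≤ (lam X (bumpC ((2 * i + 1) / (2 * m)) (1 / (2 * m)) δ) (bumpC ((2 * j + 1) / (2 * m)) (1 / (2 * m)) δ)).re := by
  set f := bump ((2 * i + 1) / (2 * m)) (1 / (2 * m)) δ with hf
  set g := bump ((2 * j + 1) / (2 * m)) (1 / (2 * m)) δ with hg
  have h1 : lam X (bumpC ((2 * i + 1) / (2 * m)) (1 / (2 * m)) δ) (bumpC ((2 * j + 1) / (2 * m)) (1 / (2 * m)) δ) =
    (((∑ a ∈ Finset.range X, ∑ u : (ZMod (a+1))ˣ, f (ZMod.toAddCircle (u : ZMod (a+1))) *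
    g (ZMod.toAddCircle (-((u⁻¹ : (ZMod (a+1))ˣ) : ZMod (a+1))))) / (X:ℝ)^2 : ℝ) : ℂ) := by
    simp only [lam]
    push_cast
    rfl
  rw [h1, Complex.ofReal_re]
  gcongr
  rw [boxT]
  push_cast
  refine Finset.sum_le_sum fun a _ => ?_
  rw [boxSet, Finset.card_filter]
  push_cast
  refine Finset.sum_le_sum fun u _ => ?_
  split_ifs with h
  · have e1 : 1 ≤ f (ZMod.toAddCircle (u : ZMod (a+1))) := by
      apply bump_one _ _ _ hδ
      rw [ZMod.toAddCircle_apply]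
      exact box_norm m i (a+1) _ hm (by omega) h.1
    have e2 : 1 ≤ g (ZMod.toAddCircle (-((u⁻¹ : (ZMod (a+1))ˣ) : ZMod (a+1)))) := by
      apply bump_one _ _ _ hδ
      rw [ZMod.toAddCircle_apply]
      exact box_norm m j (a+1) _ hm (by omega) h.2
    nlinarith
  · exact mul_nonneg (bump_nonneg _ _ _ _) (bump_nonneg _ _ _ _)

lemma box_limsup (m i j : ℕ) (hm : 0 < m) (ε : ℝ) (hε : 0 < ε) :
    ∀ᶠ X : ℕ in atTop, (boxT m i j X : ℝ) / X^2 ≤ 3 / Real.pi^2 / m^2 + ε := by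
  have hm' : (0:ℝ) < m := by exact_mod_cast hm
  obtain ⟨δ, hδ, hδ2⟩ : ∃ δ : ℝ, 0 < δ ∧ 3 / Real.pi^2 * (2 * (1 / (2 * m) + δ)) * (2 * (1 / (2 * m) + δ)) < 3 / Real.pi^2 / m^2 + ε := by
    have hc : ContinuousAt (fun δ : ℝ => 3 / Real.pi^2 * (2 * (1 / (2 * m) + δ)) * (2 * (1 / (2 * m) + δ))) 0 := by fun_prop
    have h0 : (fun δ : ℝ => 3 / Real.pi^2 * (2 * (1 / (2 * m) + δ)) * (2 * (1 / (2 * m) + δ))) 0 < 3 / Real.pi^2 / m^2 + ε := by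
      have : (fun δ : ℝ => 3 / Real.pi^2 * (2 * (1 / (2 * m) + δ)) * (2 * (1 / (2 * m) + δ))) 0 = 3 / Real.pi^2 / m^2 := by
        have := Real.pi_pos
        simp only [add_zero]
        field_simp
      rw [this]; linarith
    have h1 := hc.eventually_lt_const h0
    obtain ⟨δ, h2, h3⟩ := ((h1.filter_mono nhdsWithin_le_nhds).and (self_mem_nhdsWithin (s := Set.Ioi (0:ℝ)))).exists
    exact ⟨δ, h3, h2⟩
  obtain ⟨s, hs, hs0, hs1⟩ := bump_int ((2 * i + 1) / (2 * m)) (1 / (2 * m)) δ (by positivity) hδ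
  obtain ⟨t, ht, ht0, ht1⟩ := bump_int ((2 * j + 1) / (2 * m)) (1 / (2 * m)) δ (by positivity) hδ
  have hl := lam_tendsto (bumpC ((2 * i + 1) / (2 * m)) (1 / (2 * m)) δ) (bumpC ((2 * j + 1) / (2 * m)) (1 / (2 * m)) δ)
  rw [hs, ht] at hl
  have hr := (Complex.continuous_re.tendsto _).comp hl
  have e : (((3 / Real.pi ^ 2 : ℝ) : ℂ) * (s:ℂ) * (t:ℂ)).re = 3 / Real.pi^2 * s * t := by
    rw [← Complex.ofReal_mul, ← Complex.ofReal_mul, Complex.ofReal_re]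
  rw [e] at hr
  have hlt : 3 / Real.pi^2 * s * t < 3 / Real.pi^2 / m^2 + ε := by
    refine lt_of_le_of_lt ?_ hδ2
    gcongr
  filter_upwards [hr.eventually_lt_const hlt] with X hX
  exact (box_upper m i j X hm δ hδ).trans hX.le

lemma box_total (m X : ℕ) (hm : 0 < m) : ∑ i ∈ Finset.range m, ∑ j ∈ Finset.range m, boxT m i j X =
    ∑ a ∈ Finset.range X, (a+1).totient := by
  unfold boxT
  simp_rw [Finset.sum_comm (s := Finset.range m) (t := Finset.range X)]
  refine Finset.sum_congr rfl fun a _ => ?_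
  rw [← ZMod.card_units_eq_totient, ← Finset.card_univ, ← Finset.sum_product' (f := fun i j => (boxSet m i j (a+1)).card)]
  rw [Finset.card_eq_sum_card_fiberwise (f := fun u : (ZMod (a+1))ˣ => (m * (u : ZMod (a+1)).val / (a+1), m * (-((u⁻¹ : (ZMod (a+1))ˣ) : ZMod (a+1))).val / (a+1))) (t := Finset.range m ×ˢ Finset.range m)]
  · refine Finset.sum_congr rfl fun x _ => ?_
    rw [boxSet]
    congr 1
    ext u
    simp [Prod.ext_iff]
  · intro u _
    have : ∀ v : ZMod (a+1), m * v.val / (a+1) < m := by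
      intro v
      rw [Nat.div_lt_iff_lt_mul (by omega)]
      exact Nat.mul_lt_mul_of_pos_left (ZMod.val_lt v) hm
    simp [this]

lemma box_tendsto (m i j : ℕ) (hi : i < m) (hj : j < m) :
    Tendsto (fun X : ℕ => (boxT m i j X : ℝ) / X^2) atTop (nhds (3 / Real.pi^2 / m^2)) := by
  have hm : 0 < m := by omega
  have hm' : (0:ℝ) < m := by exact_mod_cast hm
  set L := 3 / Real.pi^2 / (m:ℝ)^2 with hL
  rw [Metric.tendsto_atTop']
  intro ε hε
  set η := ε / (m^2 + 1) with hη
  have hη0 : 0 < η := by positivity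
  have hηε : η * (m^2 + 1) = ε := by rw [hη]; field_simp
  have hup : ∀ᶠ X : ℕ in atTop, ∀ x ∈ Finset.range m ×ˢ Finset.range m, (boxT m x.1 x.2 X : ℝ) / X^2 ≤ L + η := by
    rw [eventually_all_finset]
    intro x _
    exact box_limsup m x.1 x.2 hm η hη0
  have htot := totient_asymp.eventually_const_lt (show 3 / Real.pi^2 - η < 3 / Real.pi^2 by linarith)
  obtain ⟨N, hN⟩ := eventually_atTop.1 (hup.and htot)
  refine ⟨N, fun X hX => ?_⟩
  obtain ⟨h1, h2⟩ := hN X hX.le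
  have hmem : (i, j) ∈ Finset.range m ×ˢ Finset.range m := by simp [hi, hj]
  have h3 : ∑ x ∈ Finset.range m ×ˢ Finset.range m, (boxT m x.1 x.2 X : ℝ) / X^2 = (∑ a ∈ Finset.range X, ((a+1).totient : ℝ)) / (X:ℝ)^2 := by
    rw [← Finset.sum_div, Finset.sum_product]
    congr 1
    exact_mod_cast box_total m X hm
  rw [← h3, ← Finset.add_sum_erase _ _ hmem] at h2
  have h4 : ∑ x ∈ (Finset.range m ×ˢ Finset.range m).erase (i,j), (boxT m x.1 x.2 X : ℝ) / X^2 ≤ (m^2 - 1) * (L + η) := by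
    refine (Finset.sum_le_card_nsmul _ _ (L + η) (fun x hx => h1 x (Finset.mem_of_mem_erase hx))).trans ?_
    rw [Finset.card_erase_of_mem hmem, Finset.card_product, Finset.card_range, nsmul_eq_mul, Nat.cast_sub (Nat.mul_pos hm hm)]
    push_cast
    rw [pow_two]
  have h5 := h1 _ hmem
  have h6 : L * m^2 = 3 / Real.pi^2 := by rw [hL]; field_simp
  simp only at h2 h5
  rw [Real.dist_eq, abs_lt]
  have h7 : 0 < η * m^2 := by positivity
  constructor
  · nlinarith
  · nlinarith

/-- Count with weights `f`, `g`, restricted to a box. -/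
noncomputable def cntBox (m i j : ℕ) (f g : ℝ → ℝ) (q : ℝ) : ℕ :=
  ∑ a ∈ Finset.range ⌊√q⌋₊, ((boxSet m i j (a+1)).filter (fun u : (ZMod (a+1))ˣ =>
    ((a+1:ℕ):ℝ)^2 ≤ q * (f ((u : ZMod (a+1)).val / (a+1:ℕ)) * g ((-((u⁻¹ : (ZMod (a+1))ˣ) : ZMod (a+1))).val / (a+1:ℕ))))).card

/-- Count with weights `f`, `g`. -/
noncomputable def cnt (f g : ℝ → ℝ) (q : ℝ) : ℕ :=
  ∑ a ∈ Finset.range ⌊√q⌋₊, ((Finset.univ : Finset (ZMod (a+1))ˣ).filter (fun u : (ZMod (a+1))ˣ =>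
    ((a+1:ℕ):ℝ)^2 ≤ q * (f ((u : ZMod (a+1)).val / (a+1:ℕ)) * g ((-((u⁻¹ : (ZMod (a+1))ˣ) : ZMod (a+1))).val / (a+1:ℕ))))).card

lemma cnt_eq (m : ℕ) (hm : 0 < m) (f g : ℝ → ℝ) (q : ℝ) :
    cnt f g q = ∑ x ∈ Finset.range m ×ˢ Finset.range m, cntBox m x.1 x.2 f g q := by
  unfold cnt cntBox
  rw [Finset.sum_comm]
  refine Finset.sum_congr rfl fun a _ => ?_
  rw [Finset.card_eq_sum_card_fiberwise (f := fun u : (ZMod (a+1))ˣ => (m * (u : ZMod (a+1)).val / (a+1), m * (-((u⁻¹ : (ZMod (a+1))ˣ) : ZMod (a+1))).val / (a+1))) (t := Finset.range m ×ˢ Finset.range m)]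
  · refine Finset.sum_congr rfl fun x _ => ?_
    rw [boxSet]
    congr 1
    ext u
    simp only [Finset.mem_filter, Finset.mem_univ, true_and, Prod.ext_iff]
    tauto
  · intro u _
    have : ∀ v : ZMod (a+1), m * v.val / (a+1) < m := by
      intro v
      rw [Nat.div_lt_iff_lt_mul (by omega)]
      exact Nat.mul_lt_mul_of_pos_left (ZMod.val_lt v) hm
    simp [this]

lemma box_lip (m i N b : ℕ) (hm : 0 < m) (hN : 0 < N) (h : m * b / N = i) (f : ℝ → ℝ)
    (hf : ∀ x y, |f x - f y| ≤ |x - y|) : |f (b / N) - f (i / m)| ≤ 1 / m := by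
  refine (hf _ _).trans ?_
  have h1 : i * N ≤ m * b := by rw [← h]; exact Nat.div_mul_le_self _ _
  have h2 : m * b < (i + 1) * N := by rw [← Nat.div_lt_iff_lt_mul hN, h]; exact Nat.lt_succ_self i
  have h1' : (i:ℝ) * N ≤ m * b := by exact_mod_cast h1
  have h2' : (m:ℝ) * b < (i + 1) * N := by exact_mod_cast h2
  have hm' : (0:ℝ) < m := by exact_mod_cast hm
  have hN' : (0:ℝ) < N := by exact_mod_cast hN
  have e : (b / N : ℝ) - i / m = (m * b - i * N) / (N * m) := by field_simp
  rw [e, abs_div, abs_of_pos (a := (N:ℝ) * m) (by positivity), div_le_div_iff₀ (by positivity) (by positivity)]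
  have : |((m:ℝ) * b) - i * N| ≤ N := by
    rw [abs_le]; constructor <;> linarith
  nlinarith

lemma cntBox_upper (m i j : ℕ) (hm : 0 < m) (f g : ℝ → ℝ) (hf : ∀ x y, |f x - f y| ≤ |x - y|)
    (hg : ∀ x y, |g x - g y| ≤ |x - y|) (hf0 : ∀ x, 0 ≤ f x) (hg0 : ∀ x, 0 ≤ g x) (q : ℝ) (hq : 0 ≤ q) :
    cntBox m i j f g q ≤ boxT m i j ⌊√(q * ((f (i/m) + 1/m) * (g (j/m) + 1/m)))⌋₊ := by
  unfold cntBox boxT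
  set Z := ⌊√(q * ((f (i/m) + 1/m) * (g (j/m) + 1/m)))⌋₊ with hZ
  calc _ ≤ ∑ a ∈ Finset.range ⌊√q⌋₊, if a ∈ Finset.range Z then (boxSet m i j (a+1)).card else 0 := by
        refine Finset.sum_le_sum fun a _ => ?_
        split_ifs with ha
        · exact Finset.card_filter_le _ _
        · rw [Nat.le_zero, Finset.card_eq_zero, Finset.filter_eq_empty_iff]
          intro u hu hP
          apply ha
          rw [Finset.mem_range, ← Nat.succ_le_iff, hZ]
          apply Nat.le_floor
          apply Real.le_sqrt_of_sq_le
          refine hP.trans ?_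
          simp only [boxSet, Finset.mem_filter, Finset.mem_univ, true_and] at hu
          have h1 := (abs_le.1 (box_lip m i (a+1) _ hm (by omega) hu.1 f hf)).2
          have h2 := (abs_le.1 (box_lip m j (a+1) _ hm (by omega) hu.2 g hg)).2
          have := hf0 (i/m)
          gcongr
          · exact hg0 _
          · linarith
          · linarith
    _ ≤ ∑ a ∈ Finset.range Z, (boxSet m i j (a+1)).card := by
        rw [← Finset.sum_filter]
        apply Finset.sum_le_sum_of_subset
        intro x hx
        exact (Finset.mem_filter.1 hx).2

lemma cntBox_lower (m i j : ℕ) (hm : 0 < m) (f g : ℝ → ℝ) (hf : ∀ x y, |f x - f y| ≤ |x - y|)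
    (hg : ∀ x y, |g x - g y| ≤ |x - y|) (hf0 : 1 / m ≤ f (i/m)) (hg0 : 1/m ≤ g (j/m))
    (hf1 : ∀ x, f x ≤ 1) (hg1 : ∀ x, g x ≤ 1) (q : ℝ) (hq : 0 ≤ q) :
    boxT m i j ⌊√(q * ((f (i/m) - 1/m) * (g (j/m) - 1/m)))⌋₊ ≤ cntBox m i j f g q := by
  unfold cntBox boxT
  have hm' : (0:ℝ) < 1 / m := by positivity
  set B := ((f (i/m) - 1/m) * (g (j/m) - 1/m)) with hB
  have hB0 : 0 ≤ B := mul_nonneg (by linarith) (by linarith)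
  have hB1 : B ≤ 1 := by
    have := hf1 (i/m)
    have := hg1 (j/m)
    apply mul_le_one₀ <;> linarith
  set Z := ⌊√(q * B)⌋₊ with hZ
  have hZY : Z ≤ ⌊√q⌋₊ := by
    apply Nat.floor_mono
    apply Real.sqrt_le_sqrt
    nlinarith
  calc _ ≤ ∑ a ∈ Finset.range Z, ((boxSet m i j (a+1)).filter (fun u : (ZMod (a+1))ˣ =>
    ((a+1:ℕ):ℝ)^2 ≤ q * (f ((u : ZMod (a+1)).val / (a+1:ℕ)) * g ((-((u⁻¹ : (ZMod (a+1))ˣ) : ZMod (a+1))).val / (a+1:ℕ))))).card := by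
        refine Finset.sum_le_sum fun a ha => ?_
        rw [Finset.filter_true_of_mem]
        intro u hu
        simp only [boxSet, Finset.mem_filter, Finset.mem_univ, true_and] at hu
        have h1 := (abs_le.1 (box_lip m i (a+1) _ hm (by omega) hu.1 f hf)).1
        have h2 := (abs_le.1 (box_lip m j (a+1) _ hm (by omega) hu.2 g hg)).1
        have h3 : ((a+1:ℕ):ℝ) ≤ √(q * B) := by
          have : a + 1 ≤ Z := Finset.mem_range.1 ha
          exact (Nat.le_floor_iff (by positivity)).1 this
        calc ((a+1:ℕ):ℝ)^2 ≤ √(q * B)^2 := by gcongr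
          _ = q * B := Real.sq_sqrt (by positivity)
          _ ≤ _ := by
            rw [hB]
            gcongr
            · linarith
            · linarith
            · linarith
    _ ≤ _ := by
        apply Finset.sum_le_sum_of_subset
        exact Finset.range_mono hZY

lemma boxT_sqrt (m i j : ℕ) (hi : i < m) (hj : j < m) (A : ℝ) (hA : 0 ≤ A) :
    Tendsto (fun q : ℝ => (boxT m i j ⌊√(q * A)⌋₊ : ℝ) / q) atTop (nhds (3 / Real.pi^2 / m^2 * A)) := by
  rcases hA.eq_or_lt with rfl | hA
  · simp [boxT]
  have h0 : Tendsto (fun q : ℝ => √(q * A)) atTop atTop :=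
    Real.tendsto_sqrt_atTop.comp (tendsto_id.atTop_mul_const hA)
  have h1 : Tendsto (fun q : ℝ => ⌊√(q * A)⌋₊) atTop atTop := tendsto_nat_floor_atTop.comp h0
  have h2 := (box_tendsto m i j hi hj).comp h1
  have h3 := (tendsto_nat_floor_div_atTop (R := ℝ)).comp h0
  have h4 := h2.mul ((h3.pow 2).mul_const A)
  rw [one_pow, one_mul] at h4
  refine h4.congr' ?_
  filter_upwards [eventually_gt_atTop 0, h1.eventually_gt_atTop 0] with q hq hfl
  simp only [Function.comp]
  have : (0:ℝ) < (⌊√(q * A)⌋₊ : ℝ) := by exact_mod_cast hfl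
  rw [div_pow, Real.sq_sqrt (by positivity)]
  field_simp

lemma riemann (f : ℝ → ℝ) (hf : ∀ x y, |f x - f y| ≤ |x - y|) (m : ℕ) (hm : 0 < m) :
    |∑ i ∈ Finset.range m, f (i/m) * (1/m) - ∫ x in (0:ℝ)..1, f x| ≤ 1 / m := by
  have hm' : (0:ℝ) < m := by exact_mod_cast hm
  have hc : Continuous f := by
    have : LipschitzWith 1 f := LipschitzWith.of_dist_le_mul fun x y => by
      simpa [Real.dist_eq] using hf x y
    exact this.continuous
  have h1 := intervalIntegral.sum_integral_adjacent_intervals (μ := MeasureTheory.volume) (f := f) (a := fun i : ℕ => (i:ℝ)/m) (n := m) (fun k _ => hc.intervalIntegrable _ _)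
  simp only [Nat.cast_zero, zero_div, div_self hm'.ne'] at h1
  rw [← h1, ← Finset.sum_sub_distrib]
  calc _ ≤ ∑ i ∈ Finset.range m, (1/m * (1/m) : ℝ) := by
        refine (Finset.abs_sum_le_sum_abs _ _).trans (Finset.sum_le_sum fun i _ => ?_)
        have hle : (i:ℝ)/m ≤ ((i+1:ℕ):ℝ)/m := by gcongr; simp
        have hd : ((i+1:ℕ):ℝ)/m - (i:ℝ)/m = 1/m := by push_cast; field_simp; ring
        have e : f (i/m) * (1/m) = ∫ x in ((i:ℝ)/m)..(((i+1:ℕ):ℝ)/m), f (i/m) := by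
          rw [intervalIntegral.integral_const, hd, smul_eq_mul, mul_comm]
        rw [e, ← intervalIntegral.integral_sub (by simp) (hc.intervalIntegrable _ _)]
        have := intervalIntegral.norm_integral_le_of_norm_le_const (a := (i:ℝ)/m) (b := ((i+1:ℕ):ℝ)/m) (f := fun x => f (i/m) - f x) (C := 1/m) (by
          intro x hx
          rw [Set.uIoc_of_le hle] at hx
          refine (hf _ _).trans ?_
          rw [abs_le]
          constructor <;> linarith [hx.1, hx.2])
        rw [hd, abs_of_pos (by positivity : (0:ℝ) < 1/m)] at this
        exact this
    _ = 1 / m := by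
        rw [Finset.sum_const, Finset.card_range, nsmul_eq_mul]
        field_simp

lemma cnt_tendsto (f g : ℝ → ℝ) (hf : ∀ x y, |f x - f y| ≤ |x - y|)
    (hg : ∀ x y, |g x - g y| ≤ |x - y|) (hf0 : ∀ x, 0 ≤ f x) (hg0 : ∀ x, 0 ≤ g x)
    (hf2 : ∀ x, 0 ≤ x → x ≤ 1 → 1/2 ≤ f x) (hg2 : ∀ x, 0 ≤ x → x ≤ 1 → 1/2 ≤ g x)
    (hf1 : ∀ x, f x ≤ 1) (hg1 : ∀ x, g x ≤ 1) :
    Tendsto (fun q : ℝ => (cnt f g q : ℝ) / q) atTop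
      (nhds (3 / Real.pi^2 * ((∫ x in (0:ℝ)..1, f x) * ∫ x in (0:ℝ)..1, g x))) := by
  set F := ∫ x in (0:ℝ)..1, f x with hF
  set G := ∫ x in (0:ℝ)..1, g x with hG
  have hpi := Real.pi_pos
  have hFh : 1/2 ≤ F := by
    have := intervalIntegral.integral_mono_on (a := 0) (b := 1) (f := fun _ => (1/2:ℝ)) (g := f) (μ := MeasureTheory.volume) zero_le_one (by simp) (by
      have : LipschitzWith 1 f := LipschitzWith.of_dist_le_mul fun x y => by
        simpa [Real.dist_eq] using hf x y
      exact this.continuous.intervalIntegrable _ _) (fun x hx => hf2 x hx.1 hx.2)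
    simpa using this
  have hGh : 1/2 ≤ G := by
    have := intervalIntegral.integral_mono_on (a := 0) (b := 1) (f := fun _ => (1/2:ℝ)) (g := g) (μ := MeasureTheory.volume) zero_le_one (by simp) (by
      have : LipschitzWith 1 g := LipschitzWith.of_dist_le_mul fun x y => by
        simpa [Real.dist_eq] using hg x y
      exact this.continuous.intervalIntegrable _ _) (fun x hx => hg2 x hx.1 hx.2)
    simpa using this
  rw [tendsto_order]
  have hinv : Tendsto (fun m : ℕ => 1 / (m:ℝ)) atTop (nhds 0) := tendsto_one_div_atTop_nhds_zero_nat
  constructor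
  · intro c hc
    have ht : Tendsto (fun m : ℕ => 3 / Real.pi^2 * ((F - 2 * (1/(m:ℝ))) * (G - 2 * (1/(m:ℝ))))) atTop (nhds (3 / Real.pi^2 * (F * G))) := by
      have := (((hinv.const_mul 2).const_sub F).mul ((hinv.const_mul 2).const_sub G)).const_mul (3 / Real.pi^2)
      simpa using this
    obtain ⟨m, hm1, hm2⟩ := ((ht.eventually_const_lt hc).and (eventually_ge_atTop 4)).exists
    have hm : 0 < m := by omega
    have hm' : (4:ℝ) ≤ m := by exact_mod_cast hm2
    have hm4 : 1/(m:ℝ) ≤ 1/4 := by gcongr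
    have hlow : ∀ i < m, ∀ h : ℝ → ℝ, (∀ x, 0 ≤ x → x ≤ 1 → 1/2 ≤ h x) → 1/(m:ℝ) ≤ h (i/m) := by
      intro i hi h hh
      have := hh (i/m) (by positivity) (by
        rw [div_le_one (by positivity)]; exact_mod_cast hi.le)
      linarith
    have hlim : Tendsto (fun q : ℝ => ∑ x ∈ Finset.range m ×ˢ Finset.range m, (boxT m x.1 x.2 ⌊√(q * ((f (x.1/m) - 1/m) * (g (x.2/m) - 1/m)))⌋₊ : ℝ) / q) atTop (nhds (∑ x ∈ Finset.range m ×ˢ Finset.range m, 3 / Real.pi^2 / m^2 * ((f (x.1/m) - 1/m) * (g (x.2/m) - 1/m)))) := by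
      refine tendsto_finsetSum _ fun x hx => ?_
      rw [Finset.mem_product, Finset.mem_range, Finset.mem_range] at hx
      apply boxT_sqrt m x.1 x.2 hx.1 hx.2
      exact mul_nonneg (sub_nonneg.2 (hlow _ hx.1 f hf2)) (sub_nonneg.2 (hlow _ hx.2 g hg2))
    have hval : ∑ x ∈ Finset.range m ×ˢ Finset.range m, 3 / Real.pi^2 / m^2 * ((f (x.1/m) - 1/m) * (g (x.2/m) - 1/m)) = 3 / Real.pi^2 * ((∑ i ∈ Finset.range m, f (i/m) * (1/m) - 1/m) * (∑ i ∈ Finset.range m, g (i/m) * (1/m) - 1/m)) := by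
      have e : ∀ h : ℝ → ℝ, ∑ i ∈ Finset.range m, h (i/m) * (1/m) - 1/(m:ℝ) = ∑ i ∈ Finset.range m, (h (i/m) - 1/m) * (1/m) := by
        intro h
        simp only [sub_mul, Finset.sum_sub_distrib, Finset.sum_const, Finset.card_range, nsmul_eq_mul]
        field_simp
      rw [e f, e g, Finset.sum_mul_sum, ← Finset.sum_product', Finset.mul_sum]
      refine Finset.sum_congr rfl fun x _ => ?_
      ring
    rw [hval] at hlim
    have hfin : c < 3 / Real.pi^2 * ((∑ i ∈ Finset.range m, f (i/m) * (1/m) - 1/m) * (∑ i ∈ Finset.range m, g (i/m) * (1/m) - 1/m)) := by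
      refine hm1.trans_le ?_
      have r1 := (abs_le.1 (riemann f hf m hm)).1
      have r2 := (abs_le.1 (riemann g hg m hm)).1
      have p2 : 0 < 1 / (m:ℝ) := by positivity
      apply mul_le_mul_of_nonneg_left _ (by positivity)
      apply mul_le_mul <;> linarith
    filter_upwards [hlim.eventually_const_lt hfin, eventually_gt_atTop 0] with q h1 hq
    refine h1.trans_le ?_
    rw [cnt_eq m hm, ← Finset.sum_div]
    push_cast
    gcongr with x hx
    rw [Finset.mem_product, Finset.mem_range, Finset.mem_range] at hx
    exact cntBox_lower m x.1 x.2 hm f g hf hg (hlow _ hx.1 f hf2) (hlow _ hx.2 g hg2) hf1 hg1 q hq.le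
  · intro c hc
    have ht : Tendsto (fun m : ℕ => 3 / Real.pi^2 * ((F + 2 * (1/(m:ℝ))) * (G + 2 * (1/(m:ℝ))))) atTop (nhds (3 / Real.pi^2 * (F * G))) := by
      have := (((hinv.const_mul 2).const_add F).mul ((hinv.const_mul 2).const_add G)).const_mul (3 / Real.pi^2)
      simpa using this
    obtain ⟨m, hm1, hm2⟩ := ((ht.eventually_lt_const hc).and (eventually_ge_atTop 4)).exists
    have hm : 0 < m := by omega
    have hm' : (4:ℝ) ≤ m := by exact_mod_cast hm2
    have hlim : Tendsto (fun q : ℝ => ∑ x ∈ Finset.range m ×ˢ Finset.range m, (boxT m x.1 x.2 ⌊√(q * ((f (x.1/m) + 1/m) * (g (x.2/m) + 1/m)))⌋₊ : ℝ) / q) atTop (nhds (∑ x ∈ Finset.range m ×ˢ Finset.range m, 3 / Real.pi^2 / m^2 * ((f (x.1/m) + 1/m) * (g (x.2/m) + 1/m)))) := by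
      refine tendsto_finsetSum _ fun x hx => ?_
      rw [Finset.mem_product, Finset.mem_range, Finset.mem_range] at hx
      apply boxT_sqrt m x.1 x.2 hx.1 hx.2
      have := hf0 (x.1/m)
      have := hg0 (x.2/m)
      positivity
    have hval : ∑ x ∈ Finset.range m ×ˢ Finset.range m, 3 / Real.pi^2 / m^2 * ((f (x.1/m) + 1/m) * (g (x.2/m) + 1/m)) = 3 / Real.pi^2 * ((∑ i ∈ Finset.range m, f (i/m) * (1/m) + 1/m) * (∑ i ∈ Finset.range m, g (i/m) * (1/m) + 1/m)) := by
      have e : ∀ h : ℝ → ℝ, ∑ i ∈ Finset.range m, h (i/m) * (1/m) + 1/(m:ℝ) = ∑ i ∈ Finset.range m, (h (i/m) + 1/m) * (1/m) := by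
        intro h
        simp only [add_mul, Finset.sum_add_distrib, Finset.sum_const, Finset.card_range, nsmul_eq_mul]
        field_simp
      rw [e f, e g, Finset.sum_mul_sum, ← Finset.sum_product', Finset.mul_sum]
      refine Finset.sum_congr rfl fun x _ => ?_
      ring
    rw [hval] at hlim
    have hfin : 3 / Real.pi^2 * ((∑ i ∈ Finset.range m, f (i/m) * (1/m) + 1/m) * (∑ i ∈ Finset.range m, g (i/m) * (1/m) + 1/m)) < c := by
      refine lt_of_le_of_lt ?_ hm1
      have r1 := (abs_le.1 (riemann f hf m hm)).2
      have r2 := (abs_le.1 (riemann g hg m hm)).2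
      have p1 : 0 ≤ ∑ i ∈ Finset.range m, g (i/m) * (1/m) := Finset.sum_nonneg fun i _ => mul_nonneg (hg0 _) (by positivity)
      have p2 : 0 < 1 / (m:ℝ) := by positivity
      apply mul_le_mul_of_nonneg_left _ (by positivity)
      apply mul_le_mul <;> linarith
    filter_upwards [hlim.eventually_lt_const hfin, eventually_gt_atTop 0] with q h1 hq
    refine lt_of_le_of_lt ?_ h1
    rw [cnt_eq m hm, ← Finset.sum_div]
    push_cast
    gcongr with x hx
    exact cntBox_upper m x.1 x.2 hm f g hf hg hf0 hg0 q hq.le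

/-- The weight `1/(1+(x-e)²)`. -/
noncomputable def wt (e : ℝ) (x : ℝ) : ℝ := (1 + (x - e)^2)⁻¹

lemma wt_lip (e x y : ℝ) : |wt e x - wt e y| ≤ |x - y| := by
  unfold wt
  set s := x - e with hs
  set t := y - e with ht
  have e1 : x - y = s - t := by rw [hs, ht]; ring
  rw [e1]
  have hs0 : 0 < 1 + s^2 := by positivity
  have ht0 : 0 < 1 + t^2 := by positivity
  have e2 : (1 + s^2)⁻¹ - (1 + t^2)⁻¹ = (s - t) * (-(s + t) / ((1 + s^2) * (1 + t^2))) := by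
    field_simp
    ring
  rw [e2, abs_mul]
  apply mul_le_of_le_one_right (abs_nonneg _)
  rw [abs_div, abs_neg, abs_of_pos (a := (1 + s^2) * (1 + t^2)) (by positivity), div_le_one (by positivity), abs_le]
  constructor <;> nlinarith [sq_nonneg (s+1), sq_nonneg (t+1), sq_nonneg (s-1), sq_nonneg (t-1), sq_nonneg (s*t)]

lemma wt_tendsto (e e' : ℝ) (he : e = 0 ∨ e = 1) (he' : e' = 0 ∨ e' = 1) :
    Tendsto (fun q : ℝ => (cnt (wt e) (wt e') q : ℝ) / q) atTop (nhds (3 / 16)) := by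
  have hwint : ∀ e : ℝ, (e = 0 ∨ e = 1) → ∫ x in (0:ℝ)..1, wt e x = Real.pi / 4 := by
    intro e he
    unfold wt
    rw [intervalIntegral.integral_comp_sub_right (fun x => (1 + x^2)⁻¹), integral_inv_one_add_sq]
    rcases he with rfl | rfl <;> simp
  have hh : ∀ e : ℝ, (e = 0 ∨ e = 1) → ∀ x, 0 ≤ x → x ≤ 1 → 1/2 ≤ wt e x := by
    intro e he x h0 h1
    unfold wt
    rw [one_div]
    apply inv_anti₀ (by positivity)
    rcases he with rfl | rfl <;> nlinarith
  have h0 : ∀ e x, 0 ≤ wt e x := fun e x => by unfold wt; positivity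
  have h1 : ∀ e x, wt e x ≤ 1 := fun e x => by
    unfold wt
    apply inv_le_one_of_one_le₀
    nlinarith [sq_nonneg (x - e)]
  have := cnt_tendsto (wt e) (wt e') (wt_lip e) (wt_lip e') (h0 e) (h0 e') (hh e he) (hh e' he') (h1 e) (h1 e')
  rw [hwint e he, hwint e' he'] at this
  have e3 : 3 / Real.pi^2 * (Real.pi / 4 * (Real.pi / 4)) = 3 / 16 := by
    have := Real.pi_pos
    field_simp
    norm_num
  rwa [e3] at this

/-- Quadruples `(a,b,c,d)` with `ad - bc = 1` and `a²+b²+c²+d² ≤ R²`. -/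
def quadT (R : ℝ) : Set (ℤ × ℤ × ℤ × ℤ) :=
  {x | x.1 * x.2.2.2 - x.2.1 * x.2.2.1 = 1 ∧
    ((x.1 ^ 2 + x.2.1 ^ 2 + x.2.2.1 ^ 2 + x.2.2.2 ^ 2 : ℤ) : ℝ) ≤ R ^ 2}

/-- Those quadruples for which the first entry is positive, at least two, and strictly dominant. -/
def quadS (R : ℝ) : Set (ℤ × ℤ × ℤ × ℤ) :=
  {x | x ∈ quadT R ∧ 2 ≤ x.1 ∧ (-x.1 < x.2.1 ∧ x.2.1 < x.1) ∧ (-x.1 < x.2.2.1 ∧ x.2.2.1 < x.1) ∧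
    (-x.1 < x.2.2.2 ∧ x.2.2.2 < x.1)}

lemma newman_ncard (R : ℝ) : (newmanSet R).ncard = (quadT R).ncard := by
  refine Set.ncard_congr (fun p _ => (p.1 0, p.1 1, p.2 0, p.2 1)) ?_ ?_ ?_
  · rintro p ⟨_, _, h1, h2⟩
    exact ⟨h1, h2⟩
  · rintro ⟨v, w⟩ ⟨v', w'⟩ _ _ h
    simp only [Prod.mk.injEq] at h
    obtain ⟨h1, h2, h3, h4⟩ := h
    refine Prod.ext ?_ ?_
    · funext i; fin_cases i <;> assumption
    · funext i; fin_cases i <;> assumption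
  · rintro ⟨a, b, c, d⟩ ⟨h1, h2⟩
    simp only at h1 h2
    refine ⟨(![a, b], ![c, d]), ⟨?_, ?_, ?_, ?_⟩, ?_⟩
    · rw [← Int.isCoprime_iff_gcd_eq_one]
      exact ⟨d, -c, by simp; linarith⟩
    · rw [← Int.isCoprime_iff_gcd_eq_one]
      exact ⟨-b, a, by simp; linarith⟩
    · simpa using h1
    · simpa using h2
    · simp

lemma quadT_finite (R : ℝ) : (quadT R).Finite := by
  have hK : ∀ a : ℤ, ((a^2 : ℤ) : ℝ) ≤ R^2 → a ∈ Set.Icc (-⌈|R|⌉) ⌈|R|⌉ := by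
    intro a ha
    push_cast at ha
    have h1 := sq_le_sq.1 ha
    have h2 : |(a:ℝ)| ≤ ((⌈|R|⌉ : ℤ) : ℝ) := h1.trans (Int.le_ceil _)
    rw [Set.mem_Icc, ← abs_le]
    exact_mod_cast h2
  refine Set.Finite.subset ((Set.finite_Icc (-⌈|R|⌉) ⌈|R|⌉).prod ((Set.finite_Icc (-⌈|R|⌉) ⌈|R|⌉).prod
    ((Set.finite_Icc (-⌈|R|⌉) ⌈|R|⌉).prod (Set.finite_Icc (-⌈|R|⌉) ⌈|R|⌉)))) ?_
  rintro ⟨a, b, c, d⟩ ⟨_, h⟩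
  simp only at h
  refine ⟨hK _ (le_trans ?_ h), hK _ (le_trans ?_ h), hK _ (le_trans ?_ h), hK _ (le_trans ?_ h)⟩ <;>
  · norm_cast
    nlinarith [sq_nonneg a, sq_nonneg b, sq_nonneg c, sq_nonneg d]

lemma quadS_finite (R : ℝ) : (quadS R).Finite := (quadT_finite R).subset fun _ h => h.1

lemma tie (a b c d : ℤ) (h : a * d - b * c = 1) (ha : 2 ≤ a) (hb : -a ≤ b ∧ b ≤ a) (hc : -a ≤ c ∧ c ≤ a)
    (hd : -a ≤ d ∧ d ≤ a) : (-a < b ∧ b < a) ∧ (-a < c ∧ c < a) ∧ (-a < d ∧ d < a) := by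
  have key : ∀ t : ℤ, a * t ≠ 1 := by
    intro t ht
    have := Int.eq_one_or_neg_one_of_mul_eq_one ht
    omega
  have b1 : b ≠ a := by rintro rfl; exact key (d - c) (by linarith)
  have b2 : b ≠ -a := by rintro rfl; exact key (d + c) (by linarith)
  have c1 : c ≠ a := by rintro rfl; exact key (d - b) (by linarith)
  have c2 : c ≠ -a := by rintro rfl; exact key (d + b) (by linarith)
  have hb1 : b ≤ a - 1 := by omega
  have hb2 : -(a - 1) ≤ b := by omega
  have hc1 : c ≤ a - 1 := by omega
  have hc2 : -(a - 1) ≤ c := by omega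
  have hbc : |b * c| ≤ (a-1) * (a-1) := by
    rw [abs_mul]
    exact mul_le_mul (abs_le.2 ⟨hb2, hb1⟩) (abs_le.2 ⟨hc2, hc1⟩) (abs_nonneg _) (by omega)
  have hbc' := abs_le.1 hbc
  have d1 : d ≠ a := by rintro rfl; nlinarith [hbc'.1, hbc'.2]
  have d2 : d ≠ -a := by rintro rfl; nlinarith [hbc'.1, hbc'.2]
  omega

/-- The eight symmetries. -/
def symQ (k : Fin 8) (x : ℤ × ℤ × ℤ × ℤ) : ℤ × ℤ × ℤ × ℤ :=
  match k with
  | 0 => (x.1, x.2.1, x.2.2.1, x.2.2.2)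
  | 1 => (x.2.2.2, x.2.1, x.2.2.1, x.1)
  | 2 => (-x.2.1, x.1, -x.2.2.2, x.2.2.1)
  | 3 => (x.2.2.1, x.2.2.2, -x.1, -x.2.1)
  | 4 => (-x.1, -x.2.1, -x.2.2.1, -x.2.2.2)
  | 5 => (-x.2.2.2, -x.2.1, -x.2.2.1, -x.1)
  | 6 => (x.2.1, -x.1, x.2.2.2, -x.2.2.1)
  | 7 => (-x.2.2.1, -x.2.2.2, x.1, x.2.1)

lemma symQ_mem (R : ℝ) (k : Fin 8) (x : ℤ × ℤ × ℤ × ℤ) (hx : x ∈ quadT R) : symQ k x ∈ quadT R := by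
  obtain ⟨a, b, c, d⟩ := x
  obtain ⟨h1, h2⟩ := hx
  simp only at h1 h2
  fin_cases k <;> refine ⟨by simp only [symQ]; linarith, le_trans (le_of_eq ?_) h2⟩ <;>
    simp only [symQ] <;> push_cast <;> ring

lemma lower_T (R : ℝ) : 8 * (quadS R).ncard ≤ (quadT R).ncard := by
  classical
  have hS := quadS_finite R
  have hT := quadT_finite R
  rw [Set.ncard_eq_toFinset_card _ hS, Set.ncard_eq_toFinset_card _ hT]
  have e : 8 * hS.toFinset.card = ((Finset.univ : Finset (Fin 8)) ×ˢ hS.toFinset).card := by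
    simp
  rw [e]
  apply Finset.card_le_card_of_injOn (fun y => symQ y.1 y.2)
  · rintro ⟨k, x⟩ h
    simp only [Finset.coe_product, Set.mem_prod, Finset.mem_coe, Set.Finite.mem_toFinset] at h
    simp only [Finset.mem_coe, Set.Finite.mem_toFinset]
    exact symQ_mem R k x h.2.1
  · rintro ⟨k, a, b, c, d⟩ h ⟨l, a', b', c', d'⟩ h' heq
    simp only [Finset.coe_product, Set.mem_prod, Finset.mem_coe, Set.Finite.mem_toFinset] at h h'
    obtain ⟨-, -, h⟩ := h
    obtain ⟨-, -, h'⟩ := h'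
    simp only at h h' heq
    fin_cases k <;> fin_cases l <;> simp only [symQ, Prod.mk.injEq] at heq ⊢ <;>
      first
      | (exfalso; omega)
      | (refine ⟨trivial, ?_⟩; omega)

lemma upper_T (R : ℝ) : (quadT R).ncard ≤ 8 * (quadS R).ncard + 81 := by
  classical
  have hS := quadS_finite R
  have hT := quadT_finite R
  rw [Set.ncard_eq_toFinset_card _ hS, Set.ncard_eq_toFinset_card _ hT]
  have e : 8 * hS.toFinset.card = ((Finset.univ : Finset (Fin 8)) ×ˢ hS.toFinset).card := by
    simp
  set I : Finset ℤ := Finset.Icc (-1) 1 with hI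
  have e2 : 81 = (I ×ˢ I ×ˢ I ×ˢ I).card := by
    simp [hI]
  have hsub : hT.toFinset ⊆ (((Finset.univ : Finset (Fin 8)) ×ˢ hS.toFinset).image (fun y => symQ y.1 y.2)) ∪ (I ×ˢ I ×ˢ I ×ˢ I) := by
    rintro ⟨a, b, c, d⟩ h
    rw [Set.Finite.mem_toFinset] at h
    rw [Finset.mem_union]
    by_cases hsm : (a, b, c, d) ∈ I ×ˢ I ×ˢ I ×ˢ I
    · exact Or.inr hsm
    left
    simp only [Finset.mem_product, hI, Finset.mem_Icc] at hsm
    rw [Finset.mem_image]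
    have main : ∀ k l : Fin 8, ∀ a' b' c' d' : ℤ, symQ l (a, b, c, d) = (a', b', c', d') →
        symQ k (a', b', c', d') = (a, b, c, d) → 2 ≤ a' → (-a' ≤ b' ∧ b' ≤ a') → (-a' ≤ c' ∧ c' ≤ a') → (-a' ≤ d' ∧ d' ≤ a') →
        ∃ y ∈ (Finset.univ : Finset (Fin 8)) ×ˢ hS.toFinset, symQ y.1 y.2 = (a, b, c, d) := by
      intro k l a' b' c' d' h1 h2 g1 g2 g3 g4
      refine ⟨(k, a', b', c', d'), ?_, h2⟩
      have hm : (a', b', c', d') ∈ quadT R := h1 ▸ symQ_mem R l _ h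
      simp only [Finset.mem_product, Finset.mem_univ, true_and, Set.Finite.mem_toFinset]
      obtain ⟨t1, t2, t3⟩ := tie a' b' c' d' hm.1 g1 g2 g3 g4
      exact ⟨hm, g1, t1, t2, t3⟩
    have hM : ∃ M : ℤ, (M = |a| ∨ M = |b| ∨ M = |c| ∨ M = |d|) ∧ |a| ≤ M ∧ |b| ≤ M ∧ |c| ≤ M ∧ |d| ≤ M := by
      refine ⟨max (max |a| |b|) (max |c| |d|), ?_, by simp, by simp, by simp, by simp⟩
      rcases max_choice (max |a| |b|) (max |c| |d|) with h1 | h1 <;> rw [h1]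
      · rcases max_choice |a| |b| with h2 | h2 <;> simp [h2]
      · rcases max_choice |c| |d| with h2 | h2 <;> simp [h2]
    obtain ⟨M, hM1, ha, hb, hc, hd⟩ := hM
    rw [abs_le] at ha hb hc hd
    have hM2 : 2 ≤ M := by
      by_contra hlt
      apply hsm
      omega
    clear hsm
    have fin : ∀ x y : ℤ, 2 ≤ M → M = x → (-M ≤ y ∧ y ≤ M) → (-x ≤ y ∧ y ≤ x) ∧ (-x ≤ -y ∧ -y ≤ x) := by
      intro x y _ h1 h2
      omega
    rcases hM1 with h0 | h0 | h0 | h0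
    · rcases abs_choice a with h' | h' <;> rw [h'] at h0
      · exact main 0 0 _ _ _ _ rfl (by simp [symQ]) (h0 ▸ hM2) (fin _ _ hM2 h0 hb).1 (fin _ _ hM2 h0 hc).1 (fin _ _ hM2 h0 hd).1
      · exact main 4 4 _ _ _ _ rfl (by simp [symQ]) (h0 ▸ hM2) (fin _ _ hM2 h0 hb).2 (fin _ _ hM2 h0 hc).2 (fin _ _ hM2 h0 hd).2
    · rcases abs_choice b with h' | h' <;> rw [h'] at h0
      · exact main 2 6 _ _ _ _ rfl (by simp [symQ]) (h0 ▸ hM2) (fin _ _ hM2 h0 ha).2 (fin _ _ hM2 h0 hd).1 (fin _ _ hM2 h0 hc).2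
      · exact main 6 2 _ _ _ _ rfl (by simp [symQ]) (h0 ▸ hM2) (fin _ _ hM2 h0 ha).1 (fin _ _ hM2 h0 hd).2 (fin _ _ hM2 h0 hc).1
    · rcases abs_choice c with h' | h' <;> rw [h'] at h0
      · exact main 7 3 _ _ _ _ rfl (by simp [symQ]) (h0 ▸ hM2) (fin _ _ hM2 h0 hd).1 (fin _ _ hM2 h0 ha).2 (fin _ _ hM2 h0 hb).2
      · exact main 3 7 _ _ _ _ rfl (by simp [symQ]) (h0 ▸ hM2) (fin _ _ hM2 h0 hd).2 (fin _ _ hM2 h0 ha).1 (fin _ _ hM2 h0 hb).1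
    · rcases abs_choice d with h' | h' <;> rw [h'] at h0
      · exact main 1 1 _ _ _ _ rfl (by simp [symQ]) (h0 ▸ hM2) (fin _ _ hM2 h0 hb).1 (fin _ _ hM2 h0 hc).1 (fin _ _ hM2 h0 ha).1
      · exact main 5 5 _ _ _ _ rfl (by simp [symQ]) (h0 ▸ hM2) (fin _ _ hM2 h0 hb).2 (fin _ _ hM2 h0 hc).2 (fin _ _ hM2 h0 ha).2
  rw [e]
  conv_rhs => rw [e2]
  refine (Finset.card_le_card hsub).trans ((Finset.card_union_le _ _).trans ?_)
  gcongr
  exact Finset.card_image_le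

lemma wt_cond (A b c q : ℝ) (hA : 0 < A) :
    A^2 ≤ q * ((1 + (b/A)^2)⁻¹ * (1 + (c/A)^2)⁻¹) ↔ A^2 + b^2 + c^2 + (b*c/A)^2 ≤ q := by
  have h : q * ((1 + (b/A)^2)⁻¹ * (1 + (c/A)^2)⁻¹) = q / ((1 + (b/A)^2) * (1 + (c/A)^2)) := by
    rw [div_eq_mul_inv q, mul_inv]
  rw [h, le_div_iff₀ (by positivity)]
  have e : A^2 * ((1 + (b/A)^2) * (1 + (c/A)^2)) = A^2 + b^2 + c^2 + (b*c/A)^2 := by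
    field_simp
    ring
  rw [e]

lemma wt_diff (A b c d : ℝ) (hA : 1 ≤ A) (hb : -A ≤ b ∧ b ≤ A) (hc : -A ≤ c ∧ c ≤ A) (h : A * d - b * c = 1) :
    |d^2 - (b*c/A)^2| ≤ 3 := by
  have hd : d = (1 + b*c)/A := by
    rw [eq_div_iff (by positivity)]; linarith
  have e : d^2 - (b*c/A)^2 = (1 + 2 * (b*c)) / A^2 := by
    rw [hd]; field_simp; ring
  have hbc : |b * c| ≤ A * A := by
    rw [abs_mul]
    exact mul_le_mul (abs_le.2 hb) (abs_le.2 hc) (abs_nonneg _) (by linarith)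
  rw [abs_le] at hbc
  rw [e, abs_div, abs_of_pos (a := A^2) (by positivity), div_le_iff₀ (by positivity), abs_le]
  constructor <;> nlinarith

/-- The finset whose cardinality is `cnt`. -/
noncomputable def cntF (e e' : ℕ) (q : ℝ) : Finset (Σ a : ℕ, (ZMod (a+1))ˣ) :=
  (Finset.range ⌊√q⌋₊).sigma fun a => (Finset.univ : Finset (ZMod (a+1))ˣ).filter (fun u : (ZMod (a+1))ˣ =>
    ((a+1:ℕ):ℝ)^2 ≤ q * (wt e ((u : ZMod (a+1)).val / (a+1:ℕ)) * wt e' ((-((u⁻¹ : (ZMod (a+1))ˣ) : ZMod (a+1))).val / (a+1:ℕ))))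

lemma cntF_card (e e' : ℕ) (q : ℝ) : (cntF e e' q).card = cnt (wt e) (wt e') q := by
  rw [cntF, Finset.card_sigma, cnt]

/-- The quadruple attached to a modulus and a unit. -/
def toQuad (e e' : ℕ) (y : Σ a : ℕ, (ZMod (a+1))ˣ) : ℤ × ℤ × ℤ × ℤ :=
  (((y.1+1:ℕ):ℤ), ((y.2 : ZMod (y.1+1)).val : ℤ) - e * (y.1+1:ℕ),
    ((-((y.2⁻¹ : (ZMod (y.1+1))ˣ) : ZMod (y.1+1))).val : ℤ) - e' * (y.1+1:ℕ),
    (1 + (((y.2 : ZMod (y.1+1)).val : ℤ) - e * (y.1+1:ℕ)) * (((-((y.2⁻¹ : (ZMod (y.1+1))ˣ) : ZMod (y.1+1))).val : ℤ) - e' * (y.1+1:ℕ))) / (y.1+1:ℕ))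

lemma wt_val (e A v : ℕ) (hA : 0 < A) : wt e ((v:ℝ) / (A:ℕ)) = (1 + (((((v:ℤ) - e * A : ℤ)) : ℝ) / (A:ℝ))^2)⁻¹ := by
  unfold wt
  have : (A:ℝ) ≠ 0 := by positivity
  congr 3
  push_cast
  field_simp

lemma upper_S (R : ℝ) : (quadS R).ncard ≤ ∑ x ∈ Finset.range 2 ×ˢ Finset.range 2, cnt (wt x.1) (wt x.2) (R^2+3) := by
  classical
  have hS := quadS_finite R
  rw [Set.ncard_eq_toFinset_card _ hS]
  have hsub : hS.toFinset ⊆ (Finset.range 2 ×ˢ Finset.range 2).biUnion (fun x => (cntF x.1 x.2 (R^2+3)).image (toQuad x.1 x.2)) := by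
    rintro ⟨a, b, c, d⟩ h
    rw [Set.Finite.mem_toFinset] at h
    obtain ⟨⟨hdet, hnorm⟩, ha, hb, hc, hd⟩ := h
    simp only at hdet hnorm ha hb hc hd
    obtain ⟨n, rfl⟩ : ∃ n : ℕ, a = ((n+1:ℕ):ℤ) := ⟨(a-1).toNat, by omega⟩
    have hval : ∀ t : ℤ, (-((n+1:ℕ):ℤ) < t ∧ t < ((n+1:ℕ):ℤ)) → ∃ e < 2, ((t : ZMod (n+1)).val : ℤ) - (e:ℕ) * ((n+1:ℕ):ℤ) = t := by
      intro t ht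
      rw [ZMod.val_intCast]
      by_cases h0 : 0 ≤ t
      · refine ⟨0, by norm_num, ?_⟩
        rw [Int.emod_eq_of_lt h0 ht.2]; simp
      · refine ⟨1, by norm_num, ?_⟩
        rw [← Int.add_emod_right, Int.emod_eq_of_lt (by omega) (by omega)]; simp
    obtain ⟨e, he, hbe⟩ := hval b hb
    obtain ⟨e', he', hce⟩ := hval c hc
    have hmod : (b : ZMod (n+1)) * (-(c : ZMod (n+1))) = 1 := by
      have h1 : (((n+1:ℕ):ℤ) * d - b * c : ℤ) = (1:ℤ) := hdet
      have h2 := congrArg (fun z : ℤ => (z : ZMod (n+1))) h1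
      simp only [Int.cast_sub, Int.cast_mul, Int.cast_natCast, ZMod.natCast_self, zero_mul, zero_sub, Int.cast_one] at h2
      rw [← h2]; ring
    let u : (ZMod (n+1))ˣ := ⟨(b : ZMod (n+1)), -(c : ZMod (n+1)), hmod, by rw [mul_comm]; exact hmod⟩
    have hu1 : (u : ZMod (n+1)) = (b : ZMod (n+1)) := rfl
    have hu2 : -((u⁻¹ : (ZMod (n+1))ˣ) : ZMod (n+1)) = (c : ZMod (n+1)) := by
      change -(-(c : ZMod (n+1))) = _
      rw [neg_neg]
    rw [Finset.mem_biUnion]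
    refine ⟨(e, e'), by simp [he, he'], ?_⟩
    rw [Finset.mem_image]
    refine ⟨⟨n, u⟩, ?_, ?_⟩
    · have hq0 : 0 ≤ R^2 + 3 := by positivity
      have hP : ((n+1:ℕ):ℝ)^2 + (b:ℝ)^2 + (c:ℝ)^2 + ((b:ℝ)*c/((n+1:ℕ):ℝ))^2 ≤ R^2 + 3 := by
        have hdet' : ((n+1:ℕ):ℝ) * d - b * c = 1 := by exact_mod_cast hdet
        have := wt_diff ((n+1:ℕ):ℝ) b c d (by simp)
          ⟨by exact_mod_cast hb.1.le, by exact_mod_cast hb.2.le⟩ ⟨by exact_mod_cast hc.1.le, by exact_mod_cast hc.2.le⟩ hdet'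
        rw [abs_le] at this
        push_cast at hnorm this ⊢
        linarith [this.1]
      rw [cntF, Finset.mem_sigma, Finset.mem_range, Finset.mem_filter]
      refine ⟨?_, Finset.mem_univ _, ?_⟩
      · rw [← Nat.succ_le_iff]
        apply Nat.le_floor
        apply Real.le_sqrt_of_sq_le
        have : 0 ≤ (b:ℝ)^2 + (c:ℝ)^2 + ((b:ℝ)*c/((n+1:ℕ):ℝ))^2 := by positivity
        simp only [Nat.succ_eq_add_one]
        linarith
      · simp only
        rw [hu1, hu2, wt_val _ _ _ (by omega), wt_val _ _ _ (by omega), hbe, hce, wt_cond _ _ _ _ (by positivity)]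
        exact hP
    · simp only [toQuad]
      rw [hu1, hu2, hbe, hce]
      have : (1 + b * c) / ((n+1:ℕ):ℤ) = d := by
        apply Int.ediv_eq_of_eq_mul_right (by omega)
        linarith
      rw [this]
  refine (Finset.card_le_card hsub).trans (Finset.card_biUnion_le.trans ?_)
  refine Finset.sum_le_sum fun x _ => ?_
  rw [← cntF_card]
  exact Finset.card_image_le

lemma lower_S (R : ℝ) (hR : 2 ≤ R) : ∑ x ∈ Finset.range 2 ×ˢ Finset.range 2, cnt (wt x.1) (wt x.2) (R^2-3) ≤ (quadS R).ncard + 4 := by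
  classical
  have hS := quadS_finite R
  rw [Set.ncard_eq_toFinset_card _ hS]
  set D : ℕ × ℕ → Finset (Σ a : ℕ, (ZMod (a+1))ˣ) := fun x => (cntF x.1 x.2 (R^2-3)).filter (fun y => y.1 ≠ 0) with hD
  have hcard : ∀ x, cnt (wt x.1) (wt x.2) (R^2-3) ≤ (D x).card + 1 := by
    intro x
    rw [← cntF_card, ← Finset.card_filter_add_card_filter_not (s := cntF x.1 x.2 (R^2-3)) (fun y => y.1 ≠ 0)]
    gcongr
    rw [Finset.card_le_one]
    rintro ⟨a, u⟩ h ⟨a', u'⟩ h'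
    simp only [Finset.mem_filter, not_not] at h h'
    obtain ⟨-, rfl⟩ := h
    obtain ⟨-, rfl⟩ := h'
    have : Subsingleton (ZMod (0+1))ˣ := inferInstanceAs (Subsingleton (ZMod 1)ˣ)
    rw [Subsingleton.elim u u']
  have hneg : ∀ (e : ℕ), e < 2 → ∀ (A v : ℕ), v < A → ((v:ℤ) - e * A < 0 ↔ e = 1) := by
    intro e he A v hv
    interval_cases e <;> simp <;> omega
  have hlt : ∀ y : (Σ a : ℕ, (ZMod (a+1))ˣ), (y.2 : ZMod (y.1+1)).val < y.1 + 1 ∧ (-((y.2⁻¹ : (ZMod (y.1+1))ˣ) : ZMod (y.1+1))).val < y.1 + 1 :=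
    fun y => ⟨ZMod.val_lt _, ZMod.val_lt _⟩
  have hinj : ∀ x ∈ Finset.range 2 ×ˢ Finset.range 2, ∀ x' ∈ Finset.range 2 ×ˢ Finset.range 2, ∀ y y',
      toQuad x.1 x.2 y = toQuad x'.1 x'.2 y' → x = x' ∧ y = y' := by
    rintro ⟨e, f⟩ hx ⟨e', f'⟩ hx' ⟨a, u⟩ ⟨a', u'⟩ h
    simp only [Finset.mem_product, Finset.mem_range] at hx hx'
    simp only [toQuad, Prod.mk.injEq] at h
    obtain ⟨h1, h2, h3, -⟩ := h
    have haa : a = a' := by omega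
    subst haa
    have l1 := hlt ⟨a, u⟩
    have l2 := hlt ⟨a, u'⟩
    simp only at l1 l2
    have n1 := hneg e hx.1 _ _ l1.1
    have n2 := hneg e' hx'.1 _ _ l2.1
    have n3 := hneg f hx.2 _ _ l1.2
    have n4 := hneg f' hx'.2 _ _ l2.2
    rw [h2, n2] at n1
    rw [h3, n4] at n3
    have he : e = e' := by omega
    have hf : f = f' := by omega
    subst he hf
    refine ⟨rfl, ?_⟩
    have : u = u' := by
      apply Units.ext
      apply ZMod.val_injective
      omega
    rw [this]
  have hsub : (Finset.range 2 ×ˢ Finset.range 2).biUnion (fun x => (D x).image (toQuad x.1 x.2)) ⊆ hS.toFinset := by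
    intro z hz
    rw [Finset.mem_biUnion] at hz
    obtain ⟨⟨e, e'⟩, hx, hz⟩ := hz
    rw [Finset.mem_image] at hz
    obtain ⟨⟨n, u⟩, hy, rfl⟩ := hz
    simp only [hD, cntF, Finset.mem_filter, Finset.mem_sigma, Finset.mem_univ, true_and] at hy
    obtain ⟨⟨-, hP⟩, hn⟩ := hy
    simp only [Finset.mem_product, Finset.mem_range] at hx
    rw [Set.Finite.mem_toFinset]
    have : Fact (1 < n + 1) := ⟨by omega⟩
    have : Nontrivial (ZMod (n+1)) := ZMod.nontrivial (n+1)
    have l1 := hlt ⟨n, u⟩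
    have p1 : 0 < (u : ZMod (n+1)).val := by
      rw [ZMod.val_pos]; exact u.ne_zero
    have p2 : 0 < (-((u⁻¹ : (ZMod (n+1))ˣ) : ZMod (n+1))).val := by
      rw [ZMod.val_pos]; exact neg_ne_zero.2 (u⁻¹).ne_zero
    simp only [toQuad]
    simp only at l1
    rw [wt_val _ _ _ (by omega), wt_val _ _ _ (by omega), wt_cond _ _ _ _ (by positivity)] at hP
    set b : ℤ := ((u : ZMod (n+1)).val : ℤ) - e * (n+1:ℕ) with hb
    set c : ℤ := ((-((u⁻¹ : (ZMod (n+1))ˣ) : ZMod (n+1))).val : ℤ) - e' * (n+1:ℕ) with hc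
    have hbnd : ∀ (e : ℕ), e < 2 → ∀ (v : ℕ), 0 < v → v < n + 1 → -((n+1:ℕ):ℤ) < (v:ℤ) - e * (n+1:ℕ) ∧ (v:ℤ) - e * (n+1:ℕ) < ((n+1:ℕ):ℤ) := by
      intro e he v h0 h1
      interval_cases e <;> simp <;> omega
    have hb' := hbnd e hx.1 _ p1 l1.1
    have hc' := hbnd e' hx.2 _ p2 l1.2
    rw [← hb] at hb'
    rw [← hc] at hc'
    have hdvd : ((n+1:ℕ):ℤ) ∣ 1 + b * c := by
      rw [← ZMod.intCast_zmod_eq_zero_iff_dvd]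
      rw [hb, hc]
      push_cast
      simp only [ZMod.natCast_val, ZMod.cast_id', id_eq]
      have hz : ((n:ZMod (n+1)) + 1) = 0 := by exact_mod_cast ZMod.natCast_self (n+1)
      rw [hz]
      simp
    obtain ⟨d, hd⟩ := hdvd
    have hdd : (1 + b * c) / ((n+1:ℕ):ℤ) = d := by
      apply Int.ediv_eq_of_eq_mul_right (by omega)
      exact hd
    rw [hdd]
    have hdet : ((n+1:ℕ):ℤ) * d - b * c = 1 := by linarith
    have hbc : |b * c| ≤ (n:ℤ) * n := by
      rw [abs_mul]
      exact mul_le_mul (abs_le.2 ⟨by omega, by omega⟩) (abs_le.2 ⟨by omega, by omega⟩) (abs_nonneg _) (by omega)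
    rw [abs_le] at hbc
    have hn1 : (1:ℤ) ≤ n := by omega
    refine ⟨⟨hdet, ?_⟩, ?_, hb', hc', ?_, ?_⟩
    · simp only
      have hdet' : ((n+1:ℕ):ℝ) * d - b * c = 1 := by exact_mod_cast hdet
      have := wt_diff ((n+1:ℕ):ℝ) b c d (by simp)
          ⟨by exact_mod_cast hb'.1.le, by exact_mod_cast hb'.2.le⟩ ⟨by exact_mod_cast hc'.1.le, by exact_mod_cast hc'.2.le⟩ hdet'
      rw [abs_le] at this
      push_cast at this hP ⊢
      linarith [this.2]
    · simp only; omega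
    · simp only
      push_cast at hd ⊢
      nlinarith [hbc.1, hbc.2]
    · simp only
      push_cast at hd ⊢
      nlinarith [hbc.1, hbc.2]
  have hle := Finset.card_le_card hsub
  rw [Finset.card_biUnion] at hle
  · calc ∑ x ∈ Finset.range 2 ×ˢ Finset.range 2, cnt (wt x.1) (wt x.2) (R^2-3)
        ≤ ∑ x ∈ Finset.range 2 ×ˢ Finset.range 2, (((D x).image (toQuad x.1 x.2)).card + 1) := by
          refine Finset.sum_le_sum fun x hx => ?_
          rw [Finset.card_image_of_injective]
          · exact hcard x
          · intro y y' h
            exact (hinj x hx x hx y y' h).2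
      _ ≤ _ := by
          rw [Finset.sum_add_distrib]
          simp only [Finset.sum_const, Finset.card_product, Finset.card_range, smul_eq_mul]
          omega
  · intro x hx x' hx' hne
    change Disjoint _ _
    rw [Finset.disjoint_left]
    intro z hz hz'
    rw [Finset.mem_image] at hz hz'
    obtain ⟨y, _, rfl⟩ := hz
    obtain ⟨y', _, h⟩ := hz'
    exact hne (hinj x hx x' hx' y y' h.symm).1

lemma sum_wt_tendsto : Tendsto (fun q : ℝ => (∑ x ∈ Finset.range 2 ×ˢ Finset.range 2, (cnt (wt x.1) (wt x.2) q : ℝ)) / q) atTop (nhds (3/4)) := by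
  have h : Tendsto (fun q : ℝ => ∑ x ∈ Finset.range 2 ×ˢ Finset.range 2, (cnt (wt x.1) (wt x.2) q : ℝ) / q) atTop (nhds (∑ x ∈ Finset.range 2 ×ˢ Finset.range 2, (3/16 : ℝ))) := by
    refine tendsto_finsetSum _ fun x hx => ?_
    simp only [Finset.mem_product, Finset.mem_range] at hx
    have c : ∀ e : ℕ, e < 2 → (e:ℝ) = 0 ∨ (e:ℝ) = 1 := by
      intro e he
      interval_cases e <;> simp
    exact wt_tendsto _ _ (c _ hx.1) (c _ hx.2)
  have e : (∑ x ∈ Finset.range 2 ×ˢ Finset.range 2, (3/16 : ℝ)) = 3/4 := by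
    simp; norm_num
  rw [e] at h
  refine h.congr fun q => ?_
  rw [Finset.sum_div]

/-- Newman's theorem: the number of pairs `(v₁, v₂)` of primitive integer vectors with
`det(v₁ v₂) = 1` and `‖v₁‖² + ‖v₂‖² ≤ R²` is asymptotic to `6R²` as `R → ∞`. -/
theorem newman_count_asymptotic :
    Tendsto (fun R : ℝ => ((newmanSet R).ncard : ℝ) / (6 * R ^ 2)) atTop (nhds 1) := by
  have hsq : Tendsto (fun R : ℝ => R^2) atTop atTop := tendsto_pow_atTop two_ne_zero
  have hi : Tendsto (fun R : ℝ => (R^2)⁻¹) atTop (nhds 0) := tendsto_inv_atTop_zero.comp hsq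
  have hup : Tendsto (fun R : ℝ => R^2 + 3) atTop atTop := tendsto_atTop_add_const_right _ _ hsq
  have hlo : Tendsto (fun R : ℝ => R^2 - 3) atTop atTop := tendsto_atTop_add_const_right _ _ hsq
  have hU : Tendsto (fun R : ℝ => 8/6 * ((∑ x ∈ Finset.range 2 ×ˢ Finset.range 2, (cnt (wt x.1) (wt x.2) (R^2+3) : ℝ)) / (R^2+3) * (1 + 3 * (R^2)⁻¹)) + 81/6 * (R^2)⁻¹) atTop (nhds 1) := by
    have := (((sum_wt_tendsto.comp hup).mul ((hi.const_mul 3).const_add 1)).const_mul (8/6)).add (hi.const_mul (81/6))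
    have e : (8 / 6 * (3 / 4 * (1 + 3 * 0)) + 81 / 6 * 0 : ℝ) = 1 := by norm_num
    rw [e] at this
    exact this
  have hL : Tendsto (fun R : ℝ => 8/6 * ((∑ x ∈ Finset.range 2 ×ˢ Finset.range 2, (cnt (wt x.1) (wt x.2) (R^2-3) : ℝ)) / (R^2-3) * (1 - 3 * (R^2)⁻¹)) - 32/6 * (R^2)⁻¹) atTop (nhds 1) := by
    have := (((sum_wt_tendsto.comp hlo).mul ((hi.const_mul 3).const_sub 1)).const_mul (8/6)).sub (hi.const_mul (32/6))
    have e : (8 / 6 * (3 / 4 * (1 - 3 * 0)) - 32 / 6 * 0 : ℝ) = 1 := by norm_num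
    rw [e] at this
    exact this
  refine tendsto_of_tendsto_of_tendsto_of_le_of_le' hL hU ?_ ?_
  · filter_upwards [eventually_ge_atTop 2] with R hR
    have h1 := lower_S R hR
    have h2 := lower_T R
    rw [← newman_ncard] at h2
    have h3 : (∑ x ∈ Finset.range 2 ×ˢ Finset.range 2, (cnt (wt x.1) (wt x.2) (R^2-3) : ℝ)) ≤ (quadS R).ncard + 4 := by exact_mod_cast h1
    have h4 : 8 * ((quadS R).ncard : ℝ) ≤ (newmanSet R).ncard := by exact_mod_cast h2
    have hR3 : R^2 - 3 ≠ 0 := by nlinarith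
    have hR0 : 0 < R^2 := by positivity
    set s := (∑ x ∈ Finset.range 2 ×ˢ Finset.range 2, (cnt (wt x.1) (wt x.2) (R^2-3) : ℝ))
    have e : 8/6 * (s / (R^2-3) * (1 - 3 * (R^2)⁻¹)) - 32/6 * (R^2)⁻¹ = (8 * s - 32) / (6 * R^2) := by
      field_simp
    rw [e]
    gcongr
    linarith
  · filter_upwards [eventually_ge_atTop 2] with R hR
    have h1 := upper_S R
    have h2 := upper_T R
    rw [← newman_ncard] at h2
    have h3 : ((quadS R).ncard : ℝ) ≤ (∑ x ∈ Finset.range 2 ×ˢ Finset.range 2, (cnt (wt x.1) (wt x.2) (R^2+3) : ℝ)) := by exact_mod_cast h1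
    have h4 : ((newmanSet R).ncard : ℝ) ≤ 8 * ((quadS R).ncard : ℝ) + 81 := by exact_mod_cast h2
    have hR3 : R^2 + 3 ≠ 0 := by positivity
    have hR0 : 0 < R^2 := by positivity
    set s := (∑ x ∈ Finset.range 2 ×ˢ Finset.range 2, (cnt (wt x.1) (wt x.2) (R^2+3) : ℝ))
    have e : 8/6 * (s / (R^2+3) * (1 + 3 * (R^2)⁻¹)) + 81/6 * (R^2)⁻¹ = (8 * s + 81) / (6 * R^2) := by
      field_simp
    rw [e]
    gcongr
    linarith
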